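/- arXiv:1008.1485 — 2 statements merged into one kernel-verified Lean document; each statement's English description precedes it below -/
import Mathlib

section
/- Let Q be the quiver arising from an algebraically consistent dimer model Γ, viewed as the quiver of sections of the collection E. Then every arrow a ∈ Q₁ satisfies x^{div(a)} = ∏_{ρ ∈ σ(1) with a ∈ supp(Π_ρ)} x_ρ, where Π_ρ is the unique perfect matching of Γ corresponding to the vertex ρ ∈ σ(1); in other words, the labelling monomial of a is the squarefree product of the Cox variables of exactly those rays whose extremal perfect matching contains a. -/
namespace NCCell
/-- Toric data for a normal affine toric variety `X = Spec k[σ^∨ ∩ M]` of dimension `n`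
with a torus-invariant point: the strongly convex, full-dimensional rational cone
`σ ⊆ ℝⁿ` is recorded through the primitive generators `v ρ` of its `d` extremal rays. -/
structure ToricData (n d : ℕ) where
  v : Fin d → Fin n → ℤ
  primitive : ∀ ρ, Finset.univ.gcd (fun i => (v ρ i).natAbs) = 1
  strongly_convex : ∃ u : Fin n → ℤ, ∀ ρ, 0 < ∑ i, u i * v ρ i
  full_dim : ∀ u : Fin n → ℤ, (∀ ρ, ∑ i, u i * v ρ i = 0) → u = 0
  extremal_rays : ∀ ρ : Fin d, ∃ u : Fin n → ℤ,
    (∑ i, u i * v ρ i = 0) ∧ ∀ ρ', ρ' ≠ ρ → 0 < ∑ i, u i * v ρ' i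

namespace ToricData
variable {n d : ℕ} (T : ToricData n d)
/-- The inclusion `M = ℤⁿ → ℤᵈ`, `u ↦ (⟨u, v_ρ⟩)_ρ`, from the exact sequence
`0 → M → ℤᵈ → Cl(X) → 0`. -/
def iota : (Fin n → ℤ) →+ (Fin d → ℤ) where
  toFun u := fun ρ => ∑ i, u i * T.v ρ i
  map_zero' := by funext ρ; simp
  map_add' u w := by funext ρ; simp [add_mul, Finset.sum_add_distrib]
/-- The sublattice of `ℤᵈ` of principal torus-invariant Weil divisors, i.e. the image
of `M`; the class group `Cl(X)` is the quotient `ℤᵈ ⧸ prin`. -/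
def prin : AddSubgroup (Fin d → ℤ) := T.iota.range
/-- `X` is Gorenstein: `(1,…,1)` lies in (the image of) `M`. -/
def Gorenstein : Prop := (fun _ => 1 : Fin d → ℤ) ∈ T.prin
end ToricData

def toInt {d : ℕ} (u : Fin d → ℕ) : Fin d → ℤ := fun ρ => (u ρ : ℤ)

/-- A collection of distinct rank one reflexive sheaves on `X`, recorded through Weil
divisor representatives `D i` of their divisor classes. -/
structure Collection {n d : ℕ} (T : ToricData n d) (I : Type*) where
  D : I → Fin d → ℤ
  distinct : ∀ i j : I, D i - D j ∈ T.prin → i = j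

namespace Collection
section
variable {n d : ℕ} {T : ToricData n d} {I : Type*} (C : Collection T I)
/-- `u ∈ ℕᵈ` is (the divisor of zeroes of) a torus-invariant section of
`Hom(E_i, E_j) = H⁰(X, O_X(D_j - D_i))`, i.e. `u` is effective of class `[D_j - D_i]`. -/
def IsSection (i j : I) (u : Fin d → ℕ) : Prop :=
  toInt u - (C.D j - C.D i) ∈ T.prin
/-- A torus-invariant section is irreducible if it admits no nontrivial factorisation
through a member of the collection. -/
def IsIrreducible (i j : I) (u : Fin d → ℕ) : Prop :=
  C.IsSection i j u ∧
    ∀ (l : I) (u₁ u₂ : Fin d → ℕ), u = u₁ + u₂ →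
      C.IsSection i l u₂ → C.IsSection l j u₁ →
      (l = i ∧ u₂ = 0) ∨ (l = j ∧ u₁ = 0)
/-- An arrow of the quiver of sections `Q` of the collection: an irreducible
torus-invariant section, with its head, tail and labelling divisor `div(a) ∈ ℕᵈ`. -/
structure Arrow where
  src : I
  tgt : I
  lab : Fin d → ℕ
  irred : C.IsIrreducible src tgt lab
  nontriv : ¬ (src = tgt ∧ lab = 0)
/-- Paths in the quiver of sections (`nil i` is the trivial path `e_i`, and
`cons p a _` is the path `a·p`, i.e. `a` traversed last). -/
inductive Path : I → I → Type _
  | nil (i : I) : Path i i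
  | cons {i j : I} (p : Path i j) (a : C.Arrow) (h : a.src = j) : Path i a.tgt
end

section
variable {n d : ℕ} {T : ToricData n d} {I : Type*} {C : Collection T I}
/-- The labelling divisor `div(p) ∈ ℕᵈ` of a path. -/
def Path.lab {i : I} : {j : I} → C.Path i j → (Fin d → ℕ)
  | _, .nil _ => 0
  | _, .cons p a _ => Path.lab p + a.lab
/-- Composition of paths: `p.comp q` traverses `p` first, then `q`. -/
def Path.comp {i j : I} (p : C.Path i j) : {l : I} → C.Path j l → C.Path i l
  | _, .nil _ => p
  | _, .cons q a h => .cons (Path.comp p q) a h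
/-- The arrow traversed last by a path. -/
def Path.lastArrow? {i : I} : {j : I} → C.Path i j → Option (C.Arrow)
  | _, .nil _ => none
  | _, .cons _ a _ => some a
/-- The arrow traversed first by a path. -/
def Path.firstArrow? {i : I} : {j : I} → C.Path i j → Option (C.Arrow)
  | _, .nil _ => none
  | _, .cons p a _ => some ((Path.firstArrow? p).getD a)
/-- The list of arrows traversed by a path (last traversed first). -/
def Path.arrows {i : I} : {j : I} → C.Path i j → List (C.Arrow)
  | _, .nil _ => []
  | _, .cons p a _ => a :: Path.arrows p

/-- `pp - pm` is one of the generating relations of the ideal of superpotential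
relations `J_W`: there is a path `q` such that the derivative `∂_q W` of the
superpotential `W = Σ_{p anticanonical cycle} p` is the sum of precisely the two paths
`pp` and `pm`, and these two paths share neither initial nor final arrow.  (Here
`∂_q W` is the sum of all paths `p` with tail at `h(q)`, head at `t(q)` and labelling
monomial `x^{div p} = Π_ρ x_ρ / x^{div q}`.) -/
def IsSPRel {i j : I} (pp pm : C.Path i j) : Prop :=
  ∃ q : C.Path j i,
    (∀ ρ, pp.lab ρ + q.lab ρ = 1) ∧ (∀ ρ, pm.lab ρ + q.lab ρ = 1) ∧
    pp ≠ pm ∧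
    pp.firstArrow? ≠ pm.firstArrow? ∧ pp.lastArrow? ≠ pm.lastArrow? ∧
    (∀ p : C.Path i j, (∀ ρ, p.lab ρ + q.lab ρ = 1) → p = pp ∨ p = pm)

/-- F-term equivalence of paths: the equivalence relation generated by
`q₂ p₊ q₁ ∼ q₂ p₋ q₁` for superpotential relations `p₊ - p₋ ∈ J_W`.  Two paths are
identified in the superpotential algebra `A_W = kQ/J_W` iff they are F-term equivalent. -/
inductive FTermEquiv : {i j : I} → C.Path i j → C.Path i j → Prop
  | rel {i j l m : I} {pp pm : C.Path i j} (q₁ : C.Path l i) (q₂ : C.Path j m)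
      (h : IsSPRel pp pm) :
      FTermEquiv ((q₁.comp pp).comp q₂) ((q₁.comp pm).comp q₂)
  | refl {i j : I} (p : C.Path i j) : FTermEquiv p p
  | symm {i j : I} {p q : C.Path i j} : FTermEquiv p q → FTermEquiv q p
  | trans {i j : I} {p q r : C.Path i j} : FTermEquiv p q → FTermEquiv q r → FTermEquiv p r
end

/-- The toric algebra `A_𝓔 = kQ/J_𝓔` is consistent, i.e. `J_𝓔 = J_W`: since (classes of)
paths form bases of both quotient algebras, this says precisely that two paths of `Q`
with the same head and tail are identified in `A_𝓔` (i.e. share the same labelling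
divisor) if and only if they are identified in `A_W` (i.e. are F-term equivalent). -/
def Consistent {n d : ℕ} {T : ToricData n d} {I : Type*} (C : Collection T I) : Prop :=
  ∀ (i j : I) (p q : C.Path i j), p.lab = q.lab ↔ FTermEquiv p q

end Collection
end NCCell

namespace NCCell

/-- A dimer model `Γ` on a real two-torus, recorded through the dual quiver `Q`
embedded in the torus: `src`/`tgt` give the quiver structure on the dual cell
decomposition, and `nw` (resp. `nb`) sends an arrow to the next arrow around the
boundary of the unique white (resp. black) face containing it; faces of `Q` are the
orbits of `nw` and `nb`. -/
structure DimerStruct (V A : Type) where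
  src : A → V
  tgt : A → V
  nw : Equiv.Perm A
  nb : Equiv.Perm A
  nw_src : ∀ a, src (nw a) = tgt a
  nb_src : ∀ a, src (nb a) = tgt a

namespace DimerStruct

variable {V A : Type}

/-- The number of cycles (orbits, including fixed points) of a permutation. -/
noncomputable def numCycles [Fintype A] [DecidableEq A] (σ : Equiv.Perm A) : ℕ :=
  Multiset.card σ.cycleType + (Finset.univ.filter fun a => σ a = a).card

/-- The quiver `Q`, together with its white and black faces, is a polygonal cell
decomposition of a real two-torus: the Euler characteristic
`#Q₀ - #Q₁ + #Q₂ = 0` vanishes, every vertex meets an arrow, each face is an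
embedded polygon (its boundary traverses no arrow twice), arrows are not loops, and
the quiver is connected (via the face structure this makes `|Q|` a torus). -/
def IsTorusDimer [Fintype V] [Fintype A] [DecidableEq V] [DecidableEq A]
    (D : DimerStruct V A) : Prop :=
  Fintype.card V + (numCycles D.nw + numCycles D.nb) = Fintype.card A
  ∧ (∀ v : V, ∃ a, D.src a = v)
  ∧ (∀ a : A, D.src a ≠ D.tgt a)
  ∧ (∀ a : A, Function.Injective fun m : Fin (Function.minimalPeriod (⇑D.nw) a) => (⇑D.nw)^[m] a)
  ∧ (∀ a : A, Function.Injective fun m : Fin (Function.minimalPeriod (⇑D.nb) a) => (⇑D.nb)^[m] a)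

/-- The path `p_a⁺` completing the arrow `a` to the boundary cycle of its white face:
it runs from `tgt a` back to `src a` (listed in traversal order). -/
noncomputable def wpath (D : DimerStruct V A) (a : A) : List A :=
  (List.range (Function.minimalPeriod (⇑D.nw) a - 1)).map fun m => (⇑D.nw)^[m + 1] a

/-- The path `p_a⁻` completing the arrow `a` to the boundary cycle of its black face. -/
noncomputable def bpath (D : DimerStruct V A) (a : A) : List A :=
  (List.range (Function.minimalPeriod (⇑D.nb) a - 1)).map fun m => (⇑D.nb)^[m + 1] a

/-- The boundary cycle `w_F` of the white face of `a`, based at `src a` and starting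
with `a` (in traversal order). -/
noncomputable def wcyc (D : DimerStruct V A) (a : A) : List A := a :: D.wpath a

/-- The boundary cycle of the black face of `a`, based at `src a`. -/
noncomputable def bcyc (D : DimerStruct V A) (a : A) : List A := a :: D.bpath a

/-- `IsPathFrom u l w`: the list of arrows `l` (in traversal order) is a path in the
quiver from `u` to `w`. -/
def IsPathFrom (D : DimerStruct V A) : V → List A → V → Prop
  | u, [], w => u = w
  | u, a :: l, w => D.src a = u ∧ IsPathFrom D (D.tgt a) l w

/-- The vector `v(l) ∈ ℤ^{Q₁}` of multiplicities of a path. -/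
noncomputable def cnt (l : List A) : A →₀ ℤ :=
  (l.map fun a => Finsupp.single a (1 : ℤ)).sum

/-- F-term equivalence of paths (recorded with their source vertices) of the dimer
model: the equivalence relation generated by replacing `p_a⁺` by `p_a⁻` in any path
context, i.e. by the F-term relations `∂_a W_Γ = p_a⁺ - p_a⁻`. -/
inductive FTerm (D : DimerStruct V A) : V × List A → V × List A → Prop
  | rel (u : V) (l₁ l₂ : List A) (a : A) :
      FTerm D (u, l₁ ++ D.wpath a ++ l₂) (u, l₁ ++ D.bpath a ++ l₂)
  | refl (x) : FTerm D x x
  | symm {x y} : FTerm D x y → FTerm D y x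
  | trans {x y z} : FTerm D x y → FTerm D y z → FTerm D x z

/-- Algebraic consistency of the dimer model (Broomhead): the superpotential algebra
`A_Γ = kQ/(∂_a W_Γ)` is isomorphic to the toric algebra constructed from the toric
data encoded by `Γ`; equivalently, two paths of `Q` with the same source and target
are F-term equivalent whenever their multiplicity vectors agree modulo the subgroup
generated by the vectors `v(p_a⁺) - v(p_a⁻)` of the F-term relations. -/
def AlgConsistent (D : DimerStruct V A) : Prop :=
  ∀ (u w : V) (l l' : List A), D.IsPathFrom u l w → D.IsPathFrom u l' w →
    cnt l - cnt l' ∈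
      AddSubgroup.closure {x : A →₀ ℤ | ∃ a, x = cnt (D.wpath a) - cnt (D.bpath a)} →
    FTerm D (u, l) (u, l')

/-- A perfect matching of the dimer model `Γ`, described dually: a set of arrows
containing precisely one arrow of the boundary of each (white or black) face of `Q`
— i.e. a set of edges of `Γ` covering each vertex of the bipartite graph exactly once. -/
def IsPerfectMatching (D : DimerStruct V A) (S : Set A) : Prop :=
  (∀ a : A, ∃! b, D.nw.SameCycle a b ∧ b ∈ S) ∧
  (∀ a : A, ∃! b, D.nb.SameCycle a b ∧ b ∈ S)

end DimerStruct
end NCCell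

open NCCell DimerStruct Collection

section
variable {V A : Type} [Fintype V] [Fintype A] [DecidableEq V] [DecidableEq A]

/-- The label sum `div(l) ∈ ℕᵈ` of a path of the dimer quiver, computed through an
identification `φ` of its arrows with the arrows of a quiver of sections. -/
def labSum {n d : ℕ} {T : ToricData n d} {C : Collection T V}
    (φ : A ≃ C.Arrow) (l : List A) : Fin d → ℕ :=
  fun ρ => (l.map fun a => (φ a).lab ρ).sum

end


namespace DimerLabel

open Finset
open scoped Classical

section LocalGraph

variable {V A : Type}

/-- In a connected subgraph of a graph whose edges `b` join `α b` to `β b`, with `α` injective,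
at most one vertex is not of the form `α b`. -/
theorem eq_of_not_mem_image {α β : Equiv.Perm A} {E : Set A} {X : Set A}
    (hconn : ∀ S : Set A, (∀ b ∈ E, (α b ∈ S ↔ β b ∈ S)) → ∀ a ∈ X, ∀ a' ∈ X, (a ∈ S ↔ a' ∈ S))
    {a a' : A} (ha : a ∈ X) (ha' : a' ∈ X) (hna : ∀ b ∈ E, α b ≠ a) (hna' : ∀ b ∈ E, α b ≠ a') :
    a = a' := by
  let step : A → A → Prop := fun x y => ∃ b ∈ E, α b = x ∧ β b = y
  have hS := hconn {x | Relation.ReflTransGen step x a} (by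
    intro b hb
    constructor
    · intro h
      rcases Relation.ReflTransGen.cases_head h with h | ⟨c, ⟨b', hb', h1, h2⟩, hc⟩
      · exact absurd h (hna b hb)
      · obtain rfl := α.injective h1
        rw [← h2] at hc
        exact hc
    · intro h
      exact Relation.ReflTransGen.head ⟨b, hb, rfl, rfl⟩ h) a ha a' ha'
  have h : Relation.ReflTransGen step a' a := hS.1 Relation.ReflTransGen.refl
  rcases Relation.ReflTransGen.cases_head h with h | ⟨c, ⟨b', hb', h1, h2⟩, hc⟩
  · exact h.symm
  · exact absurd h1 (hna' b' hb')

/-- A nonempty connected subgraph of a cycle has one more vertex than edges, unless it is the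
whole cycle. -/
theorem card_vertices_of_connected {s t : A → V} {α β : Equiv.Perm A}
    (hα : ∀ a, s (α a) = t a) (i : V)
    (X E : Finset A) (hX : ∀ a ∈ X, s a = i)
    (hαX : ∀ b ∈ E, α b ∈ X) (hβX : ∀ b ∈ E, β b ∈ X) (hne : X.Nonempty)
    (hfull : ∀ S : Set A, (∀ b, t b = i → (α b ∈ S ↔ β b ∈ S)) →
      ∀ a a', s a = i → s a' = i → (a ∈ S ↔ a' ∈ S))
    (hconn : ∀ S : Set A, (∀ b ∈ E, (α b ∈ S ↔ β b ∈ S)) → ∀ a ∈ X, ∀ a' ∈ X, (a ∈ S ↔ a' ∈ S)) :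
    X.card + (if ∀ b, t b = i → b ∈ E then 1 else 0) = E.card + 1 := by
  have hsubα : E.image α ⊆ X := by
    intro a ha
    obtain ⟨b, hb, rfl⟩ := mem_image.1 ha
    exact hαX b hb
  have hsubβ : E.image β ⊆ X := by
    intro a ha
    obtain ⟨b, hb, rfl⟩ := mem_image.1 ha
    exact hβX b hb
  have hcα : (E.image α).card = E.card := card_image_of_injective _ α.injective
  have hcβ : (E.image β).card = E.card := card_image_of_injective _ β.injective
  have hle : E.card ≤ X.card := hcα ▸ card_le_card hsubα
  split_ifs with h
  · have : X ⊆ E.image α := by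
      intro a ha
      refine mem_image.2 ⟨α.symm a, h _ ?_, by simp⟩
      rw [← hα, Equiv.apply_symm_apply]
      exact hX a ha
    have := card_le_card this
    omega
  · have hup : X.card ≤ E.card + 1 := by
      have h1 : (X \ E.image α).card ≤ 1 := by
        rw [card_le_one]
        intro a ha a' ha'
        simp only [mem_sdiff, mem_image, not_exists, not_and] at ha ha'
        exact eq_of_not_mem_image (X := X) (E := E) hconn ha.1 ha'.1 ha.2 ha'.2
      have h2 := card_sdiff_add_card_eq_card hsubα
      omega
    have hlt : E.card ≠ X.card := by
      intro heq
      have eα : E.image α = X := eq_of_subset_of_card_le hsubα (by omega)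
      have eβ : E.image β = X := eq_of_subset_of_card_le hsubβ (by omega)
      obtain ⟨a₀, ha₀⟩ := hne
      apply h
      intro b hb
      have hkey := hfull (X : Set A) (by
        intro c _
        rw [mem_coe, mem_coe]
        nth_rewrite 1 [← eα]
        rw [← eβ]
        simp) a₀ (α b) (hX _ ha₀) (by rw [hα, hb])
      have : α b ∈ X := by simpa using hkey.1 (by simpa using ha₀)
      rw [← eα] at this
      simpa using this
    omega

end LocalGraph

section ToricPoints

variable {d : ℕ} (T : ToricData 3 d)

theorem iota_apply (u : Fin 3 → ℤ) (ρ : Fin d) : T.iota u ρ = ∑ i, u i * T.v ρ i := rfl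

theorem iota_injective : Function.Injective T.iota := by
  rw [injective_iff_map_eq_zero]
  intro u hu
  exact T.full_dim u fun ρ => congrFun hu ρ

/-- Two rays in a three-dimensional lattice have a common nonzero annihilator. -/
theorem exists_annihilator (ρ₁ ρ₂ : Fin d) :
    ∃ e : Fin 3 → ℤ, e ≠ 0 ∧ T.iota e ρ₁ = 0 ∧ T.iota e ρ₂ = 0 := by
  let M : Matrix (Fin 3) (Fin 3) ℤ := ![T.v ρ₁, T.v ρ₂, 0]
  have hdet : M.det = 0 := Matrix.det_eq_zero_of_row_eq_zero 2 (fun j => rfl)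
  obtain ⟨e, he, h⟩ := Matrix.exists_mulVec_eq_zero_iff.2 hdet
  refine ⟨e, he, ?_, ?_⟩
  · have := congrFun h 0
    simpa [M, Matrix.mulVec, dotProduct, ToricData.iota, mul_comm] using this
  · have := congrFun h 1
    simpa [M, Matrix.mulVec, dotProduct, ToricData.iota, mul_comm] using this

theorem exists_ne_ray {d : ℕ} (T : ToricData 3 d) (ρ : Fin d) : ∃ ρ' : Fin d, ρ' ≠ ρ := by
  by_contra! h
  obtain ⟨e, he, h1, -⟩ := exists_annihilator T ρ ρ
  refine he (T.full_dim e fun ρ' => ?_)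
  rw [h ρ']
  exact h1

theorem exists_gt_prin (N : ℕ) : ∃ u : Fin d → ℤ, u ∈ T.prin ∧ ∀ ρ, (N : ℤ) ≤ u ρ := by
  obtain ⟨e, he⟩ := T.strongly_convex
  refine ⟨T.iota ((N : ℤ) • e), ⟨_, rfl⟩, fun ρ => ?_⟩
  have h1 : T.iota ((N : ℤ) • e) ρ = N * ∑ i, e i * T.v ρ i := by
    rw [map_zsmul]
    simp [iota_apply]
  rw [h1]
  nlinarith [he ρ]

/-- A principal divisor with a prescribed coefficient along one ray and large coefficients
along all the other rays. -/
theorem exists_prin_eq_and_gt (ρ : Fin d) (c : ℤ) (N : ℕ) :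
    ∃ u : Fin d → ℤ, u ∈ T.prin ∧ u ρ = c ∧ ∀ ρ', ρ' ≠ ρ → (N : ℤ) ≤ u ρ' := by
  obtain ⟨e, he0, he⟩ := T.extremal_rays ρ
  have hgcd : (Finset.univ.gcd (T.v ρ)) = 1 := by
    have h := T.primitive ρ
    have hn : IsUnit (Finset.univ.gcd (T.v ρ)) := by
      rw [Int.isUnit_iff_natAbs_eq, ← Nat.dvd_one, ← h]
      refine Finset.dvd_gcd fun i _ => ?_
      exact Int.natAbs_dvd_natAbs.2 (Finset.gcd_dvd (Finset.mem_univ i))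
    rw [← Finset.normalize_gcd]
    exact normalize_eq_one.2 hn
  obtain ⟨m, hm⟩ := Finset.gcd_eq_sum_mul Finset.univ (T.v ρ)
  rw [hgcd] at hm
  let w : Fin d → ℤ := T.iota (c • m)
  let K : ℕ := N + ∑ ρ', (w ρ').natAbs
  refine ⟨T.iota (c • m + (K : ℤ) • e), ⟨_, rfl⟩, ?_, fun ρ' hρ' => ?_⟩
  · have h1 : T.iota (c • m + (K : ℤ) • e) ρ =
        c * ∑ i, T.v ρ i * m i + K * ∑ i, e i * T.v ρ i := by
      rw [map_add, map_zsmul, map_zsmul]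
      simp [iota_apply, mul_comm]
    rw [h1, ← hm, he0]
    ring
  · have h1 : T.iota (c • m + (K : ℤ) • e) ρ' = w ρ' + K * ∑ i, e i * T.v ρ' i := by
      rw [map_add, map_zsmul T.iota (K : ℤ)]
      rfl
    have h2 : (w ρ').natAbs ≤ ∑ ρ', (w ρ').natAbs :=
      Finset.single_le_sum (f := fun ρ' => (w ρ').natAbs) (fun _ _ => Nat.zero_le _)
        (Finset.mem_univ ρ')
    have h3 : (N : ℤ) + (w ρ').natAbs ≤ K := by
      have : N + (w ρ').natAbs ≤ K := by simp only [K]; omega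
      exact_mod_cast this
    have h4 := he ρ' hρ'
    rw [h1]
    have h5 : (0 : ℤ) ≤ K := by positivity
    have h6 : -((w ρ').natAbs : ℤ) ≤ w ρ' := by omega
    nlinarith

end ToricPoints

section EulerIdentity

variable {V A : Type} {d : ℕ}

/-- `u` represents the divisor class `[D_j - D_i]`. -/
def InClass (T : ToricData 3 d) (Dv : V → Fin d → ℤ) (i j : V) (u : Fin d → ℤ) : Prop :=
  u - (Dv j - Dv i) ∈ T.prin

theorem InClass.add_iff {T : ToricData 3 d} {Dv : V → Fin d → ℤ} {i j k : V} {u w : Fin d → ℤ}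
    (hu : InClass T Dv i j u) : InClass T Dv i k (u + w) ↔ InClass T Dv j k w := by
  unfold InClass at *
  have : u + w - (Dv k - Dv i) = (u - (Dv j - Dv i)) + (w - (Dv k - Dv j)) := by abel
  rw [this]
  exact T.prin.add_mem_cancel_left hu

theorem inClass_self_iff {T : ToricData 3 d} {Dv : V → Fin d → ℤ} {i : V} {u : Fin d → ℤ} :
    InClass T Dv i i u ↔ u ∈ T.prin := by
  simp [InClass]

theorem inClass_neg_iff {T : ToricData 3 d} {Dv : V → Fin d → ℤ} {i j : V} {u : Fin d → ℤ} :
    InClass T (fun i => -Dv i) i j u ↔ InClass T Dv j i u := by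
  unfold InClass
  rw [show u - (-Dv j - -Dv i) = u - (Dv i - Dv j) by abel]

/-- The combinatorial properties of the labels of a quiver of sections coming from a dimer model
that are used at the tails of its arrows: `g b` is the label of the two paths completing `b` to
the boundary of a face, and `f` is the common label of all faces. -/
structure LabelledDimer [Fintype V] [Fintype A] (T : ToricData 3 d) (s t : A → V)
    (α β : Equiv.Perm A) (Dv : V → Fin d → ℤ) (lab g : A → Fin d → ℕ) (f : Fin d → ℕ) :
    Prop where
  src_α : ∀ a, s (α a) = t a
  src_β : ∀ a, s (β a) = t a
  add_eq : ∀ a, lab a + g a = f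
  lab_α : ∀ b, lab (α b) ≤ g b
  lab_β : ∀ b, lab (β b) ≤ g b
  lab_ne : ∀ a, lab a ≠ 0
  distinct : ∀ i j, InClass T Dv i j 0 → i = j
  class_lab : ∀ a, InClass T Dv (s a) (t a) (toInt (lab a))
  face_mem : toInt f ∈ T.prin
  exists_le : ∀ i j (u : Fin d → ℕ), InClass T Dv i j (toInt u) → ¬(i = j ∧ u = 0) →
    ∃ a, s a = i ∧ lab a ≤ u
  connected : ∀ i j (u : Fin d → ℕ), InClass T Dv i j (toInt u) →
    ∀ S : Set A, (∀ b, t b = i → g b ≤ u → (α b ∈ S ↔ β b ∈ S)) →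
      ∀ a a', s a = i → s a' = i → lab a ≤ u → lab a' ≤ u → (a ∈ S ↔ a' ∈ S)
  euler : ∀ ρ, Fintype.card V * f ρ + 2 * ∑ a, lab a ρ = Fintype.card A * f ρ

namespace LabelledDimer

variable [Fintype V] [Fintype A] {T : ToricData 3 d} {s t : A → V}
    {α β : Equiv.Perm A} {Dv : V → Fin d → ℤ} {lab g : A → Fin d → ℕ} {f : Fin d → ℕ}

theorem lab_le (h : LabelledDimer T s t α β Dv lab g f) (a : A) : lab a ≤ f := by
  rw [← h.add_eq a]
  exact le_self_add

theorem g_le (h : LabelledDimer T s t α β Dv lab g f) (a : A) : g a ≤ f := by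
  rw [← h.add_eq a]
  exact le_add_self

theorem g_ne (h : LabelledDimer T s t α β Dv lab g f) (a : A) : g a ≠ 0 := by
  intro h0
  have := h.lab_α a
  rw [h0] at this
  exact h.lab_ne _ (le_antisymm this zero_le)

theorem class_g (h : LabelledDimer T s t α β Dv lab g f) (a : A) :
    InClass T Dv (t a) (s a) (toInt (g a)) := by
  rw [← (h.class_lab a).add_iff, inClass_self_iff]
  have : toInt (lab a) + toInt (g a) = toInt f := by
    rw [← h.add_eq a]
    funext ρ
    simp [toInt]
  rw [this]
  exact h.face_mem

theorem exists_nat_ge (T : ToricData 3 d) (f : Fin d → ℕ) :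
    ∃ u : Fin d → ℕ, toInt u ∈ T.prin ∧ f ≤ u := by
  obtain ⟨u, hu, hge⟩ := exists_gt_prin T (∑ ρ, f ρ)
  have hle : ∀ ρ, f ρ ≤ ∑ ρ, f ρ := fun ρ =>
    single_le_sum (f := f) (fun _ _ => Nat.zero_le _) (mem_univ ρ)
  refine ⟨fun ρ => (u ρ).toNat, ?_, fun ρ => ?_⟩
  · convert hu using 1
    funext ρ
    have := hge ρ
    simp only [toInt]
    omega
  · have := hge ρ
    have := hle ρ
    show f ρ ≤ (u ρ).toNat
    omega

theorem connected_full (h : LabelledDimer T s t α β Dv lab g f) (i : V) (S : Set A)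
    (hS : ∀ b, t b = i → (α b ∈ S ↔ β b ∈ S)) (a a' : A) (ha : s a = i) (ha' : s a' = i) :
    a ∈ S ↔ a' ∈ S := by
  obtain ⟨u, hu, hfu⟩ := exists_nat_ge T f
  exact h.connected i i u (inClass_self_iff.2 hu) S (fun b hb _ => hS b hb) a a' ha ha'
    ((h.lab_le a).trans hfu) ((h.lab_le a').trans hfu)

/-- Euler characteristic of the graph of arrows and relations at the vertex `i` in degree `u`. -/
theorem card_lab_le (h : LabelledDimer T s t α β Dv lab g f) {i j : V} {u : Fin d → ℕ}
    (hu : InClass T Dv i j (toInt u)) (hne : ¬(i = j ∧ u = 0)) :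
    #{a | s a = i ∧ lab a ≤ u} + (if ∀ b, t b = i → g b ≤ u then 1 else 0) =
      #{b | t b = i ∧ g b ≤ u} + 1 := by
  have key := card_vertices_of_connected (s := s) (t := t) (α := α) (β := β) h.src_α i
    {a | s a = i ∧ lab a ≤ u} {b | t b = i ∧ g b ≤ u}
    (by simp +contextual)
    (by
      intro b hb
      simp only [mem_filter, mem_univ, true_and] at hb ⊢
      exact ⟨(h.src_α b).trans hb.1, (h.lab_α b).trans hb.2⟩)
    (by
      intro b hb
      simp only [mem_filter, mem_univ, true_and] at hb ⊢
      exact ⟨(h.src_β b).trans hb.1, (h.lab_β b).trans hb.2⟩)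
    (by
      obtain ⟨a, ha⟩ := h.exists_le i j u hu hne
      exact ⟨a, by simpa using ha⟩)
    (h.connected_full i)
    (by
      intro S hS a ha a' ha'
      simp only [mem_filter, mem_univ, true_and] at hS ha ha'
      exact h.connected i j u hu S (fun b h1 h2 => hS b ⟨h1, h2⟩) a a' ha.1 ha'.1 ha.2 ha'.2)
  rw [← key]
  congr 2
  simp +contextual

/-- The Euler characteristic in degrees that are large along all rays other than `ρ`. -/
theorem card_lab_apply_le (h : LabelledDimer T s t α β Dv lab g f) (i : V) (ρ : Fin d) (c : ℕ) :
    #{a | s a = i ∧ lab a ρ ≤ c} =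
      #{b | t b = i ∧ g b ρ ≤ c} + (if ∃ b, t b = i ∧ c < g b ρ then 1 else 0) := by
  obtain ⟨u, hu, huc, hge⟩ := exists_prin_eq_and_gt T ρ c (∑ ρ, f ρ + 1)
  obtain ⟨ρ', hρ'⟩ := exists_ne_ray T ρ
  have hfle : ∀ ρ, f ρ ≤ ∑ ρ, f ρ := fun ρ =>
    single_le_sum (f := f) (fun _ _ => Nat.zero_le _) (mem_univ ρ)
  let w : Fin d → ℕ := fun ρ => (u ρ).toNat
  have hw : toInt w = u := by
    funext ρ₁
    simp only [toInt, w]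
    by_cases h1 : ρ₁ = ρ
    · subst h1
      omega
    · have := hge ρ₁ h1
      omega
  have hle : ∀ x : Fin d → ℕ, x ≤ f → (x ≤ w ↔ x ρ ≤ c) := by
    intro x hx
    have hwρ : w ρ = c := by simp [w, huc]
    constructor
    · intro hxw
      exact hwρ ▸ hxw ρ
    · intro hxc ρ₁
      by_cases h1 : ρ₁ = ρ
      · rw [h1, hwρ]
        exact hxc
      · have h2 := hge ρ₁ h1
        have h3 := hfle ρ₁
        have h4 : x ρ₁ ≤ f ρ₁ := hx ρ₁
        show x ρ₁ ≤ (u ρ₁).toNat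
        have h5 : ((∑ ρ, f ρ : ℕ) : ℤ) + 1 ≤ u ρ₁ := by exact_mod_cast h2
        omega
  have key := h.card_lab_le (i := i) (j := i) (u := w)
    (by rw [inClass_self_iff, hw]; exact hu)
    (by
      rintro ⟨-, h0⟩
      have h1 := hge ρ' hρ'
      have h2 := congrFun h0 ρ'
      simp only [w, Pi.zero_apply] at h2
      push_cast at h1
      have : (0 : ℤ) ≤ ∑ ρ, (f ρ : ℤ) := by positivity
      omega)
  simp only [hle _ (h.lab_le _), hle _ (h.g_le _)] at key
  by_cases hb : ∃ b, t b = i ∧ c < g b ρ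
  · have hnb : ¬∀ b, t b = i → g b ρ ≤ c := by
      obtain ⟨b, h1, h2⟩ := hb
      intro hall
      have := hall b h1
      omega
    rw [if_neg hnb] at key
    rw [if_pos hb]
    omega
  · have hnb : ∀ b, t b = i → g b ρ ≤ c := by
      push Not at hb
      exact hb
    rw [if_pos hnb] at key
    rw [if_neg hb]
    omega

theorem sum_card_range_le {ι : Type} [Fintype ι] (x : ι → ℕ) (n : ℕ) (hx : ∀ a, x a ≤ n) :
    ∑ c ∈ range n, #{a | x a ≤ c} + ∑ a, x a = Fintype.card ι * n := by
  have h1 : ∀ a, #{c ∈ range n | x a ≤ c} = n - x a := by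
    intro a
    have : {c ∈ range n | x a ≤ c} = Ico (x a) n := by
      ext c
      simp [and_comm]
    rw [this, Nat.card_Ico]
  have h2 : ∑ c ∈ range n, #{a | x a ≤ c} = ∑ a, (n - x a) := by
    simp only [← h1, card_filter]
    exact sum_comm
  rw [h2, ← sum_add_distrib, sum_congr rfl fun a _ => Nat.sub_add_cancel (hx a)]
  simp

/-- Every vertex is the head of an arrow whose label does not involve the ray `ρ`. -/
theorem exists_lt_g (h : LabelledDimer T s t α β Dv lab g f) (i : V) (ρ : Fin d) {c : ℕ}
    (hc : c < f ρ) : ∃ b, t b = i ∧ c < g b ρ := by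
  have hsum : ∀ c, #{a | lab a ρ ≤ c} =
      #{b | g b ρ ≤ c} + #{i | ∃ b, t b = i ∧ c < g b ρ} := by
    intro c
    have e1 := card_eq_sum_card_fiberwise (s := {a | lab a ρ ≤ c}) (t := univ) (f := s)
      (fun _ _ => mem_coe.2 (mem_univ _))
    have e2 := card_eq_sum_card_fiberwise (s := {b | g b ρ ≤ c}) (t := univ) (f := t)
      (fun _ _ => mem_coe.2 (mem_univ _))
    rw [e1, e2, card_filter, ← sum_add_distrib]
    refine sum_congr rfl fun i _ => ?_
    rw [filter_filter, filter_filter]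
    simp only [and_comm (b := s _ = i), and_comm (b := t _ = i)]
    exact h.card_lab_apply_le i ρ c
  have e1 := sum_card_range_le (fun a => lab a ρ) (f ρ) (fun a => h.lab_le a ρ)
  have e2 := sum_card_range_le (fun a => g a ρ) (f ρ) (fun a => h.g_le a ρ)
  have e3 : ∑ a, lab a ρ + ∑ a, g a ρ = Fintype.card A * f ρ := by
    have hadd : ∀ a, lab a ρ + g a ρ = f ρ := fun a => congrFun (h.add_eq a) ρ
    simp [← sum_add_distrib, hadd]
  have e4 := h.euler ρ
  simp only [hsum, sum_add_distrib] at e1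
  have e5 : ∑ c ∈ range (f ρ), #{i | ∃ b, t b = i ∧ c < g b ρ} =
      ∑ c ∈ range (f ρ), Fintype.card V := by
    rw [sum_const, card_range, smul_eq_mul, mul_comm]
    omega
  have e6 := (sum_eq_sum_iff_of_le fun c _ => card_le_univ _).1 e5 c (mem_range.2 hc)
  rw [card_eq_iff_eq_univ] at e6
  simpa using (Finset.ext_iff.1 e6 i).2 (mem_univ i)

theorem forall_g_le_iff (h : LabelledDimer T s t α β Dv lab g f) (i : V) (u : Fin d → ℕ) :
    (∀ b, t b = i → g b ≤ u) ↔ f ≤ u := by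
  constructor
  · intro hall ρ
    by_contra! hlt
    obtain ⟨b, hb, hb'⟩ := h.exists_lt_g i ρ hlt
    exact absurd (hall b hb ρ) (not_le.2 hb')
  · intro hfu b _
    exact (h.g_le b).trans hfu

theorem toInt_le_toInt {x y : Fin d → ℕ} : toInt x ≤ toInt y ↔ x ≤ y := by
  simp [Pi.le_def, toInt]

theorem card_filter_and {ι : Type} [Fintype ι] (p q : ι → Prop) :
    #{a | p a ∧ q a} = ∑ a with p a, if q a then 1 else 0 := by
  rw [← filter_filter, card_filter]

/-- The multigraded Euler characteristic of the complex of projectives resolving the simple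
module at the vertex `i`. -/
theorem euler_identity (h : LabelledDimer T s t α β Dv lab g f) {i j : V} {u : Fin d → ℤ}
    (hu : InClass T Dv i j u) :
    ((∑ a with s a = i, if toInt (lab a) ≤ u then 1 else 0) + (if toInt f ≤ u then 1 else 0) : ℤ) =
      (∑ b with t b = i, if toInt (g b) ≤ u then 1 else 0) + (if 0 ≤ u then 1 else 0)
        - (if i = j ∧ u = 0 then 1 else 0) := by
  by_cases h0 : 0 ≤ u
  · obtain ⟨w, rfl⟩ : ∃ w : Fin d → ℕ, u = toInt w :=
      ⟨fun ρ => (u ρ).toNat, by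
        funext ρ
        have := h0 ρ
        simp only [toInt, Pi.zero_apply] at this ⊢
        omega⟩
    have hw0 : toInt w = 0 ↔ w = 0 := by
      simp [funext_iff, toInt]
    simp only [toInt_le_toInt, hw0, if_pos h0]
    by_cases hz : i = j ∧ w = 0
    · obtain ⟨hij, rfl⟩ := hz
      have hl : ∀ a, ¬lab a ≤ 0 := fun a ha => h.lab_ne a (le_antisymm ha zero_le)
      have hg : ∀ a, ¬g a ≤ 0 := fun a ha => h.g_ne a (le_antisymm ha zero_le)
      have hf : ¬f ≤ 0 := by
        intro hf
        obtain ⟨u, hu, hne⟩ : ∃ u : Fin d → ℕ, toInt u ∈ T.prin ∧ u ≠ 0 := by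
          obtain ⟨u, hu, hle⟩ := exists_nat_ge T 1
          refine ⟨u, hu, ?_⟩
          rintro rfl
          have hd : ∀ ρ : Fin d, False := fun ρ => absurd (hle ρ) (by simp)
          obtain ⟨e, he⟩ := exists_ne (0 : Fin 3 → ℤ)
          exact he (T.full_dim e fun ρ => (hd ρ).elim)
        obtain ⟨a, -, -⟩ := h.exists_le i i u (inClass_self_iff.2 hu) (by simp [hne])
        exact hl a ((h.lab_le a).trans hf)
      simp [hl, hg, hf, hij]
    · have key := h.card_lab_le hu hz
      simp only [h.forall_g_le_iff, card_filter_and] at key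
      rw [if_neg hz, sub_zero]
      exact_mod_cast key
  · have hx : ∀ x : Fin d → ℕ, ¬toInt x ≤ u := by
      intro x hx
      refine h0 (le_trans (fun ρ => ?_) hx)
      simp [toInt]
    have hu0 : u ≠ 0 := by
      rintro rfl
      exact h0 le_rfl
    simp [hx, h0, hu0]

end LabelledDimer

end EulerIdentity

section ShiftOperators

variable {d : ℕ}

/-- The translation operators on functions on `ℤᵈ`. -/
noncomputable def shiftHom (d : ℕ) :
    Multiplicative (Fin d → ℕ) →* Module.End ℤ ((Fin d → ℤ) → ℤ) where
  toFun m := LinearMap.funLeft ℤ ℤ fun u => u - toInt m.toAdd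
  map_one' := by
    ext X u
    simp only [LinearMap.funLeft_apply, Module.End.one_apply, toAdd_one]
    congr 1
    funext ρ
    simp [toInt]
  map_mul' m n := by
    ext X u
    simp only [LinearMap.funLeft_apply, Module.End.mul_apply, toAdd_mul]
    congr 1
    funext ρ
    simp [toInt]
    ring

/-- The action of the polynomial ring `ℤ[ℕᵈ]` on functions on `ℤᵈ` by translations. -/
noncomputable def act (d : ℕ) :
    AddMonoidAlgebra ℤ (Fin d → ℕ) →ₐ[ℤ] Module.End ℤ ((Fin d → ℤ) → ℤ) :=
  AddMonoidAlgebra.lift ℤ _ _ (shiftHom d)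

/-- The monomial with exponent `m`. -/
noncomputable abbrev mono (m : Fin d → ℕ) : AddMonoidAlgebra ℤ (Fin d → ℕ) :=
  AddMonoidAlgebra.single m 1

theorem act_mono (m : Fin d → ℕ) (X : (Fin d → ℤ) → ℤ) (u : Fin d → ℤ) :
    act d (mono m) X u = X (u - toInt m) := by
  simp [act, mono, shiftHom, LinearMap.funLeft_apply]

theorem act_mul_apply (r r' : AddMonoidAlgebra ℤ (Fin d → ℕ)) (X : (Fin d → ℤ) → ℤ) :
    act d (r * r') X = act d r (act d r' X) := by
  rw [map_mul, Module.End.mul_apply]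

theorem act_comm (r r' : AddMonoidAlgebra ℤ (Fin d → ℕ)) (X : (Fin d → ℤ) → ℤ) :
    act d r (act d r' X) = act d r' (act d r X) := by
  rw [← act_mul_apply, mul_comm, act_mul_apply]

theorem toInt_injective : Function.Injective (toInt : (Fin d → ℕ) → Fin d → ℤ) := by
  intro x y h
  funext ρ
  have := congrFun h ρ
  simpa [toInt] using this

theorem act_single_zero_apply (r : AddMonoidAlgebra ℤ (Fin d → ℕ)) (m : Fin d → ℕ) :
    act d r (Pi.single 0 1) (toInt m) = r.coeff m := by
  induction r using AddMonoidAlgebra.induction_linear with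
  | zero => simp
  | add x y hx hy => simp [hx, hy]
  | single n c =>
    have h : act d (AddMonoidAlgebra.single n c) = c • act d (mono n) := by
      rw [← map_smul]
      simp [mono]
    rw [h, LinearMap.smul_apply, Pi.smul_apply, act_mono]
    simp [Pi.single_apply, sub_eq_zero, toInt_injective.eq_iff, Finsupp.single_apply, eq_comm]

theorem eq_zero_of_act_single_eq_zero {r : AddMonoidAlgebra ℤ (Fin d → ℕ)}
    (h : act d r (Pi.single 0 1) = 0) : r = 0 := by
  ext m
  rw [← act_single_zero_apply, h]
  simp

/-- The constant coefficient as a ring homomorphism. -/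
noncomputable def constCoeff (d : ℕ) : AddMonoidAlgebra ℤ (Fin d → ℕ) →ₐ[ℤ] ℤ :=
  AddMonoidAlgebra.lift ℤ ℤ (Fin d → ℕ)
    { toFun := fun m => if m.toAdd = 0 then 1 else 0
      map_one' := by simp
      map_mul' := fun m n => by
        by_cases hm : m.toAdd = 0 <;> by_cases hn : n.toAdd = 0 <;>
          simp [toAdd_mul, hm, hn] }

theorem constCoeff_mono (m : Fin d → ℕ) : constCoeff d (mono m) = if m = 0 then 1 else 0 := by
  simp [constCoeff, mono]

/-- The Cramer rule for a matrix of translation operators. -/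
theorem act_det {V : Type} [Fintype V] (P : Matrix V V (AddMonoidAlgebra ℤ (Fin d → ℕ)))
    (X Y : V → (Fin d → ℤ) → ℤ) (h : ∀ i, ∑ k, act d (P i k) (X k) = Y i) (k : V) :
    act d P.det (X k) = ∑ i, act d (P.adjugate k i) (Y i) := by
  have h1 : ∀ l, ∑ i, act d (P.adjugate k i) (act d (P i l) (X l)) =
      act d ((P.adjugate * P) k l) (X l) := by
    intro l
    simp only [← act_mul_apply, ← LinearMap.sum_apply, ← map_sum]
    rfl
  simp only [← h, map_sum]
  rw [sum_comm]
  simp only [h1, Matrix.adjugate_mul, Matrix.smul_apply, Matrix.one_apply, smul_eq_mul, mul_ite,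
    mul_one, mul_zero]
  rw [sum_eq_single k]
  · simp
  · intro l _ hl
    simp [Ne.symm hl]
  · simp

end ShiftOperators

section Reciprocity

variable {d : ℕ}

/-- A function on `ℤᵈ` annihilated by a nonzero polynomial in the translations. -/
def IsTors (X : (Fin d → ℤ) → ℤ) : Prop := ∃ q, q ≠ 0 ∧ act d q X = 0

theorem IsTors.add {X Y : (Fin d → ℤ) → ℤ} (hX : IsTors X) (hY : IsTors Y) : IsTors (X + Y) := by
  obtain ⟨q, hq, hqX⟩ := hX
  obtain ⟨r, hr, hrY⟩ := hY
  refine ⟨q * r, mul_ne_zero hq hr, ?_⟩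
  rw [map_add, act_mul_apply q r Y, hrY, mul_comm, act_mul_apply, hqX]
  simp

theorem IsTors.sub {X Y : (Fin d → ℤ) → ℤ} (hX : IsTors X) (hY : IsTors Y) : IsTors (X - Y) := by
  obtain ⟨r, hr, hrY⟩ := hY
  rw [sub_eq_add_neg]
  exact hX.add ⟨r, hr, by rw [map_neg, hrY, neg_zero]⟩

theorem isTors_of_periodic {X : (Fin d → ℤ) → ℤ} {e : Fin d → ℤ} (he : e ≠ 0)
    (hX : ∀ u, X (u + e) = X u) : IsTors X := by
  refine ⟨mono (fun ρ => (e ρ).toNat) - mono (fun ρ => (-e ρ).toNat), ?_, ?_⟩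
  · rw [sub_ne_zero]
    intro h
    rw [AddMonoidAlgebra.single_left_inj one_ne_zero] at h
    refine he (funext fun ρ => ?_)
    have := congrFun h ρ
    simp only [Pi.zero_apply] at this ⊢
    omega
  · ext u
    rw [map_sub, LinearMap.sub_apply, Pi.sub_apply, act_mono, act_mono, ← hX]
    have : u - toInt (fun ρ => (e ρ).toNat) + e = u - toInt (fun ρ => (-e ρ).toNat) := by
      funext ρ
      simp only [toInt, Pi.sub_apply, Pi.add_apply]
      omega
    rw [this, sub_self]
    rfl

theorem isTors_of_two_rays (T : ToricData 3 d) (ρ₁ ρ₂ : Fin d) (G : Prop → Prop → ℤ) :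
    IsTors fun u => if u ∈ T.prin then G (0 < u ρ₁) (0 < u ρ₂) else 0 := by
  obtain ⟨e, he, h1, h2⟩ := exists_annihilator T ρ₁ ρ₂
  refine isTors_of_periodic (e := T.iota e) ?_ fun u => ?_
  · rw [Ne, map_eq_zero_iff _ (iota_injective T)]
    exact he
  · have : u + T.iota e ∈ T.prin ↔ u ∈ T.prin := T.prin.add_mem_cancel_right ⟨e, rfl⟩
    simp [this, h1, h2]

/-- The integer truth value of a proposition. -/
noncomputable def ind (p : Prop) : ℤ := if p then 1 else 0

/-- The sum of the indicator functions of the open dual cone and of the opposite of the closed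
dual cone of a set of rays. -/
noncomputable def coneSum (T : ToricData 3 d) (S : Finset (Fin d)) (u : Fin d → ℤ) : ℤ :=
  if u ∈ T.prin then
    ind (∀ ρ ∈ S, 0 < u ρ) + ind (∀ ρ ∈ S, u ρ ≤ 0) else 0

theorem isTors_coneSum_triple (T : ToricData 3 d) (ρ₁ ρ₂ ρ₃ : Fin d) :
    IsTors (coneSum T {ρ₁, ρ₂, ρ₃}) := by
  have h := ((isTors_of_two_rays T ρ₁ ρ₂ fun p q => if p ∨ q then 0 else 1).sub
    (isTors_of_two_rays T ρ₁ ρ₃ fun p q => if ¬p ∧ q then 1 else 0)).add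
    (isTors_of_two_rays T ρ₂ ρ₃ fun p q => if p ∧ q then 1 else 0)
  convert h using 1
  funext u
  simp only [coneSum, ind, Pi.add_apply, Pi.sub_apply, mem_insert, mem_singleton, forall_eq_or_imp,
    forall_eq, ← not_lt]
  by_cases hu : u ∈ T.prin <;> by_cases h1 : 0 < u ρ₁ <;> by_cases h2 : 0 < u ρ₂ <;>
    by_cases h3 : 0 < u ρ₃ <;> simp [hu, h1, h2, h3]

/-- Four rays in a three-dimensional lattice satisfy a linear relation with at most two negative
coefficients. -/
theorem exists_relation (T : ToricData 3 d) (w : Fin 4 → Fin d) :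
    ∃ c : Fin 4 → ℤ, (∃ k, 0 < c k) ∧ (∃ k, c k < 0) ∧ #{k | c k < 0} ≤ 2 ∧
      ∀ u ∈ T.prin, ∑ k, c k * u (w k) = 0 := by
  let M : Matrix (Fin 4) (Fin 4) ℤ := fun k => Fin.snoc (T.v (w k)) 0
  have hdet : M.det = 0 := Matrix.det_eq_zero_of_column_eq_zero (Fin.last 3) fun k =>
    Fin.snoc_last (α := fun _ => ℤ) _ _
  obtain ⟨c, hc, hcM⟩ := Matrix.exists_vecMul_eq_zero_iff.2 hdet
  have hrel : ∀ u ∈ T.prin, ∑ k, c k * u (w k) = 0 := by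
    rintro _ ⟨m, rfl⟩
    have h1 : ∀ i : Fin 3, ∑ k, c k * T.v (w k) i = 0 := by
      intro i
      have := congrFun hcM i.castSucc
      simpa [Matrix.vecMul, dotProduct, M] using this
    simp only [iota_apply, mul_sum]
    rw [sum_comm]
    refine sum_eq_zero fun i _ => ?_
    have h2 : ∑ k, c k * (m i * T.v (w k) i) = m i * ∑ k, c k * T.v (w k) i := by
      rw [mul_sum]
      exact sum_congr rfl fun k _ => by ring
    rw [h2, h1, mul_zero]
  obtain ⟨e, he⟩ := T.strongly_convex
  have hpos : ∀ b : Fin 4 → ℤ, b ≠ 0 → (∀ u ∈ T.prin, ∑ k, b k * u (w k) = 0) →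
      ∃ k, 0 < b k := by
    intro b hb hrelb
    by_contra! hle
    have h0 := hrelb _ ⟨e, rfl⟩
    have hterm : ∀ k ∈ univ, b k * T.iota e (w k) ≤ 0 := fun k _ =>
      mul_nonpos_of_nonpos_of_nonneg (hle k) (he (w k)).le
    refine hb (funext fun k => ?_)
    have := (sum_eq_zero_iff_of_nonpos hterm).1 h0 k (mem_univ k)
    exact (mul_eq_zero.1 this).resolve_right (he (w k)).ne'
  have hreln : ∀ u ∈ T.prin, ∑ k, (-c) k * u (w k) = 0 := by
    intro u hu
    simp [hrel u hu]
  obtain ⟨k₁, hk₁⟩ := hpos c hc hrel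
  obtain ⟨k₂, hk₂⟩ := hpos (-c) (neg_ne_zero.2 hc) hreln
  rw [Pi.neg_apply, neg_pos] at hk₂
  have hcard : #{k | c k < 0} + #{k | 0 < c k} ≤ 4 := by
    rw [← card_union_of_disjoint]
    · exact card_le_univ _
    · rw [disjoint_filter]
      intro k _ h1 h2
      omega
  by_cases h2 : #{k | c k < 0} ≤ 2
  · exact ⟨c, ⟨k₁, hk₁⟩, ⟨k₂, hk₂⟩, h2, hrel⟩
  · refine ⟨-c, ⟨k₂, by simpa using hk₂⟩, ⟨k₁, by simpa using hk₁⟩, ?_, hreln⟩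
    simp only [Pi.neg_apply, neg_lt_zero]
    omega

theorem not_pos_and_nonpos {c x : Fin 4 → ℤ} (hc : ∃ k, 0 < c k) (h : ∑ k, c k * x k = 0)
    (h1 : ∀ k, 0 < c k → 0 < x k) : ∃ k, c k < 0 ∧ 0 < x k := by
  by_contra! h2
  have : 0 < ∑ k, c k * x k := by
    obtain ⟨k₀, hk₀⟩ := hc
    refine sum_pos' (fun k _ => ?_) ⟨k₀, mem_univ _, mul_pos hk₀ (h1 k₀ hk₀)⟩
    rcases lt_trichotomy (c k) 0 with hk | hk | hk
    · exact mul_nonneg_of_nonpos_of_nonpos hk.le (h2 k hk)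
    · simp [hk]
    · exact (mul_pos hk (h1 k hk)).le
  omega

theorem not_nonpos_and_pos {c x : Fin 4 → ℤ} (hc : ∃ k, c k < 0) (h : ∑ k, c k * x k = 0)
    (h1 : ∀ k, 0 < c k → x k ≤ 0) : ∃ k, c k < 0 ∧ x k ≤ 0 := by
  by_contra! h2
  have : ∑ k, c k * x k < 0 := by
    obtain ⟨k₀, hk₀⟩ := hc
    refine sum_neg' (fun k _ => ?_) ⟨k₀, mem_univ _, mul_neg_of_neg_of_pos hk₀ (h2 k₀ hk₀)⟩
    rcases lt_trichotomy (c k) 0 with hk | hk | hk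
    · exact (mul_neg_of_neg_of_pos hk (h2 k hk)).le
    · simp [hk]
    · exact mul_nonpos_of_nonneg_of_nonpos hk.le (h1 k hk)
  omega

theorem forall_mem_iff_erase {ι : Type} [DecidableEq ι] {S : Finset ι} {n : ι} (hn : n ∈ S) (p : ι → Prop) :
    (∀ ρ ∈ S, p ρ) ↔ p n ∧ ∀ ρ ∈ S.erase n, p ρ := by
  conv_lhs => rw [← insert_erase hn, forall_mem_insert]

/-- Inclusion-exclusion for the function `coneSum` with respect to two rays on the same side of a
linear relation. -/
theorem coneSum_eq (T : ToricData 3 d) {S : Finset (Fin d)} {n n' : Fin d} (hn : n ∈ S)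
    (hn' : n' ∈ S)
    (hpos : ∀ u ∈ T.prin, (∀ ρ ∈ (S.erase n).erase n', 0 < u ρ) → 0 < u n ∨ 0 < u n')
    (hneg : ∀ u ∈ T.prin, (∀ ρ ∈ (S.erase n).erase n', u ρ ≤ 0) → u n ≤ 0 ∨ u n' ≤ 0) :
    coneSum T S =
      coneSum T (S.erase n) + coneSum T (S.erase n') - coneSum T ((S.erase n).erase n') := by
  funext u
  by_cases hu : u ∈ T.prin
  · have key : ∀ p : Fin d → Prop, ((∀ ρ ∈ (S.erase n).erase n', p ρ) → p n ∨ p n') →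
        (ind (∀ ρ ∈ S, p ρ) = ind (∀ ρ ∈ S.erase n, p ρ) + ind (∀ ρ ∈ S.erase n', p ρ) -
          ind (∀ ρ ∈ (S.erase n).erase n', p ρ)) := by
      intro p hp
      by_cases hnn : n = n'
      · subst hnn
        rw [forall_mem_iff_erase hn]
        simp only [erase_idem, or_self] at hp ⊢
        generalize (∀ ρ ∈ S.erase n, p ρ) = q at hp ⊢
        by_cases h1 : q
        · simp [ind, h1, hp h1]
        · simp [ind, h1]
      · have e1 : (∀ ρ ∈ S.erase n, p ρ) ↔ p n' ∧ ∀ ρ ∈ (S.erase n).erase n', p ρ :=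
          forall_mem_iff_erase (mem_erase.2 ⟨Ne.symm hnn, hn'⟩) p
        have e2 : (∀ ρ ∈ S.erase n', p ρ) ↔ p n ∧ ∀ ρ ∈ (S.erase n).erase n', p ρ := by
          rw [erase_right_comm]
          exact forall_mem_iff_erase (mem_erase.2 ⟨hnn, hn⟩) p
        rw [forall_mem_iff_erase hn, e1, e2]
        generalize (∀ ρ ∈ (S.erase n).erase n', p ρ) = q at hp ⊢
        by_cases h1 : q
        · have h2 := hp h1
          by_cases h3 : p n <;> by_cases h4 : p n' <;> simp_all [ind]
        · simp [ind, h1]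
    have k1 := key (fun ρ => 0 < u ρ) (hpos u hu)
    have k2 := key (fun ρ => u ρ ≤ 0) (hneg u hu)
    simp only [coneSum, Pi.add_apply, Pi.sub_apply, if_pos hu, k1, k2]
    ring
  · simp [coneSum, hu]

/-- Reciprocity for three-dimensional cones: up to functions annihilated by a nonzero polynomial
in the translations, the opposite of a cone is minus its interior. -/
theorem isTors_coneSum (T : ToricData 3 d) (S : Finset (Fin d)) (hS : S.Nonempty) :
    IsTors (coneSum T S) := by
  induction S using Finset.strongInduction with
  | H S ih =>
    by_cases hcard : S.card ≤ 3
    · have h0 : 0 < S.card := hS.card_pos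
      obtain h | h | h : S.card = 1 ∨ S.card = 2 ∨ S.card = 3 := by omega
      · obtain ⟨a, rfl⟩ := card_eq_one.1 h
        simpa using isTors_coneSum_triple T a a a
      · obtain ⟨a, b, -, rfl⟩ := card_eq_two.1 h
        simpa using isTors_coneSum_triple T a a b
      · obtain ⟨a, b, c, -, -, -, rfl⟩ := card_eq_three.1 h
        exact isTors_coneSum_triple T a b c
    · obtain ⟨S', hS', hc'⟩ := exists_subset_card_eq (show 4 ≤ S.card by omega)
      let w : Fin 4 → Fin d := S'.orderEmbOfFin hc'
      have hwinj : Function.Injective w := (S'.orderEmbOfFin hc').injective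
      have hwS : ∀ k, w k ∈ S := fun k => hS' (orderEmbOfFin_mem S' hc' k)
      obtain ⟨c, hcp, hcn, hc2, hrel⟩ := exists_relation T w
      obtain ⟨k, k', hkk⟩ : ∃ k k', ({k | c k < 0} : Finset (Fin 4)) = {k, k'} := by
        have h0 : 0 < #{k | c k < 0} := card_pos.2 (by
          obtain ⟨k, hk⟩ := hcn
          exact ⟨k, by simpa using hk⟩)
        obtain h | h : #{k | c k < 0} = 1 ∨ #{k | c k < 0} = 2 := by omega
        · obtain ⟨a, ha⟩ := card_eq_one.1 h
          exact ⟨a, a, by simpa using ha⟩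
        · obtain ⟨a, b, -, hab⟩ := card_eq_two.1 h
          exact ⟨a, b, hab⟩
      have hneg : ∀ l, c l < 0 ↔ l = k ∨ l = k' := by
        intro l
        simpa using Finset.ext_iff.1 hkk l
      have hmem : ∀ l, 0 < c l → w l ∈ (S.erase (w k)).erase (w k') := by
        intro l hl
        have hk := (hneg k).2 (Or.inl rfl)
        have hk' := (hneg k').2 (Or.inr rfl)
        refine mem_erase.2 ⟨fun h => ?_, mem_erase.2 ⟨fun h => ?_, hwS l⟩⟩
        · rw [hwinj h] at hl
          omega
        · rw [hwinj h] at hl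
          omega
      rw [coneSum_eq T (hwS k) (hwS k')]
      · have hne : ((S.erase (w k)).erase (w k')).Nonempty := by
          obtain ⟨l, hl⟩ := hcp
          exact ⟨_, hmem l hl⟩
        refine ((ih _ (erase_ssubset (hwS k)) (hne.mono (erase_subset _ _))).add
          (ih _ (erase_ssubset (hwS k')) ?_)).sub
          (ih _ ((erase_subset _ _).trans_ssubset (erase_ssubset (hwS k))) hne)
        rw [erase_right_comm] at hne
        exact hne.mono (erase_subset _ _)
      · intro u hu hall
        obtain ⟨l, hl, hl'⟩ := not_pos_and_nonpos (x := fun k => u (w k)) hcp (hrel u hu)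
          fun l hl => hall _ (hmem l hl)
        rcases (hneg l).1 hl with rfl | rfl
        · exact Or.inl hl'
        · exact Or.inr hl'
      · intro u hu hall
        obtain ⟨l, hl, hl'⟩ := not_nonpos_and_pos (x := fun k => u (w k)) hcn (hrel u hu)
          fun l hl => hall _ (hmem l hl)
        rcases (hneg l).1 hl with rfl | rfl
        · exact Or.inl hl'
        · exact Or.inr hl'

end Reciprocity

section FaceLabel

variable {V A : Type} {d : ℕ}

theorem sum_sum_filter_and_eq [Fintype V] [Fintype A] (p : A → Prop) (t : A → V)
    (F : V → A → ℤ) : ∑ k, ∑ a with p a ∧ t a = k, F k a = ∑ a with p a, F (t a) a := by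
  simp only [sum_filter]
  rw [sum_comm]
  refine sum_congr rfl fun a _ => ?_
  by_cases h : p a <;> simp [h]

/-- The matrix of translation operators describing the Euler characteristics at all vertices. -/
noncomputable def symbol [Fintype A] (s t : A → V) (lab g : A → Fin d → ℕ) (f : Fin d → ℕ) :
    Matrix V V (AddMonoidAlgebra ℤ (Fin d → ℕ)) := fun i k =>
  (if i = k then 1 - mono f else 0) - ∑ a with s a = i ∧ t a = k, mono (lab a) +
    ∑ b with t b = i ∧ s b = k, mono (g b)

theorem sum_act_symbol [Fintype V] [Fintype A] (s t : A → V) (lab g : A → Fin d → ℕ)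
    (f : Fin d → ℕ) (X : V → (Fin d → ℤ) → ℤ) (i : V) (u : Fin d → ℤ) :
    (∑ k, act d (symbol s t lab g f i k) (X k)) u =
      X i u - X i (u - toInt f) - ∑ a with s a = i, X (t a) (u - toInt (lab a)) +
        ∑ b with t b = i, X (s b) (u - toInt (g b)) := by
  rw [← sum_sum_filter_and_eq (fun a => s a = i) t fun k a => X k (u - toInt (lab a)),
    ← sum_sum_filter_and_eq (fun b => t b = i) s fun k b => X k (u - toInt (g b))]
  have h1 : ∀ k, act d (if i = k then 1 - mono f else 0) (X k) u =
      if i = k then X k u - X k (u - toInt f) else 0 := by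
    intro k
    split_ifs
    · rw [map_sub, map_one, LinearMap.sub_apply, Pi.sub_apply, act_mono, Module.End.one_apply]
    · simp
  simp only [Finset.sum_apply, symbol, map_add, map_sub, map_sum, LinearMap.add_apply,
    LinearMap.sub_apply, LinearMap.sum_apply, Pi.add_apply, Pi.sub_apply, act_mono, h1,
    sum_add_distrib, sum_sub_distrib]
  simp

theorem constCoeff_symbol [Fintype V] [Fintype A] {s t : A → V} {lab g : A → Fin d → ℕ} {f : Fin d → ℕ}
    (hlab : ∀ a, lab a ≠ 0) (hg : ∀ a, g a ≠ 0) (hf : f ≠ 0) :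
    (constCoeff d).toRingHom.mapMatrix (symbol s t lab g f) = (1 : Matrix V V ℤ) := by
  ext i k
  simp only [RingHom.mapMatrix_apply, Matrix.map_apply, symbol, Matrix.one_apply,
    AlgHom.toRingHom_eq_coe, RingHom.coe_coe, map_add, map_sub, map_sum, constCoeff_mono, hlab, hg,
    if_false, sum_const_zero]
  split_ifs <;> simp [constCoeff_mono, hf]

namespace LabelledDimer

variable [Fintype V] [Fintype A] {T : ToricData 3 d} {s t : A → V}
    {α β : Equiv.Perm A} {Dv : V → Fin d → ℤ} {lab g : A → Fin d → ℕ} {f : Fin d → ℕ}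

theorem inClass_sub_lab (h : LabelledDimer T s t α β Dv lab g f) (a : A) (j : V)
    (u : Fin d → ℤ) : InClass T Dv (t a) j (u - toInt (lab a)) ↔ InClass T Dv (s a) j u := by
  rw [← (h.class_lab a).add_iff, add_sub_cancel]

theorem inClass_sub_g (h : LabelledDimer T s t α β Dv lab g f) (a : A) (j : V)
    (u : Fin d → ℤ) : InClass T Dv (s a) j (u - toInt (g a)) ↔ InClass T Dv (t a) j u := by
  rw [← (h.class_g a).add_iff, add_sub_cancel]

theorem inClass_sub_face (h : LabelledDimer T s t α β Dv lab g f) (i j : V)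
    (u : Fin d → ℤ) : InClass T Dv i j (u - toInt f) ↔ InClass T Dv i j u := by
  rw [← (inClass_self_iff.2 h.face_mem : InClass T Dv i i (toInt f)).add_iff, add_sub_cancel]

theorem toInt_add_eq (h : LabelledDimer T s t α β Dv lab g f) (a : A) :
    toInt (lab a) + toInt (g a) = toInt f := by
  rw [← h.add_eq a]
  funext ρ
  simp [toInt]

/-- The row of the symbol at `i`, applied to the indicator functions of a family of subsets of the
divisor classes. -/
theorem sum_act_symbol_ind (h : LabelledDimer T s t α β Dv lab g f) (j : V)
    (p : (Fin d → ℤ) → Prop) (i : V) (u : Fin d → ℤ) :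
    (∑ k, act d (symbol s t lab g f i k) fun w => ind (InClass T Dv k j w ∧ p w)) u =
      if InClass T Dv i j u then
        ind (p u) - ind (p (u - toInt f)) - ∑ a with s a = i, ind (p (u - toInt (lab a))) +
          ∑ b with t b = i, ind (p (u - toInt (g b)))
      else 0 := by
  rw [sum_act_symbol s t lab g f fun k w => ind (InClass T Dv k j w ∧ p w)]
  have h1 : ∑ a with s a = i, ind (InClass T Dv (t a) j (u - toInt (lab a)) ∧
      p (u - toInt (lab a))) =
        ∑ a with s a = i, ind (InClass T Dv i j u ∧ p (u - toInt (lab a))) := by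
    refine sum_congr rfl fun a ha => ?_
    rw [h.inClass_sub_lab, (mem_filter.1 ha).2]
  have h2 : ∑ b with t b = i, ind (InClass T Dv (s b) j (u - toInt (g b)) ∧
      p (u - toInt (g b))) =
        ∑ b with t b = i, ind (InClass T Dv i j u ∧ p (u - toInt (g b))) := by
    refine sum_congr rfl fun b hb => ?_
    rw [h.inClass_sub_g, (mem_filter.1 hb).2]
  rw [h1, h2, h.inClass_sub_face]
  by_cases hu : InClass T Dv i j u
  · simp [hu]
  · simp [hu, ind]

theorem sum_act_symbol_nonneg (h : LabelledDimer T s t α β Dv lab g f) (i j : V) :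
    ∑ k, act d (symbol s t lab g f i k) (fun w => ind (InClass T Dv k j w ∧ 0 ≤ w)) =
      if i = j then Pi.single 0 1 else 0 := by
  funext u
  rw [h.sum_act_symbol_ind j (fun w => 0 ≤ w)]
  split_ifs with hu hij hij
  · have := h.euler_identity hu
    simp only [ind, sub_nonneg, Pi.single_apply]
    simp only [hij, true_and] at this ⊢
    linarith
  · have := h.euler_identity hu
    simp only [ind, sub_nonneg, Pi.zero_apply]
    simp only [hij, false_and, if_false] at this ⊢
    linarith
  · subst hij
    rw [Pi.single_eq_of_ne]
    rintro rfl
    exact hu (inClass_self_iff.2 T.prin.zero_mem)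
  · rfl

theorem sum_act_symbol_nonpos (h : LabelledDimer T s t α β Dv lab g f)
    (hop : LabelledDimer T t s α⁻¹ β⁻¹ (fun i => -Dv i) lab g f) (i j : V) :
    ∑ k, act d (symbol s t lab g f i k) (fun w => ind (InClass T Dv k j w ∧ w ≤ 0)) =
      if i = j then -Pi.single (toInt f) 1 else 0 := by
  funext u
  rw [h.sum_act_symbol_ind j (fun w => w ≤ 0)]
  by_cases hu : InClass T Dv i j u
  · have hw : InClass T (fun i => -Dv i) i j (toInt f - u) := by
      rw [inClass_neg_iff, ← hu.add_iff, add_sub_cancel, inClass_self_iff]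
      exact h.face_mem
    have key := hop.euler_identity hw
    have h1 : ∀ a, toInt (lab a) ≤ toInt f - u ↔ u - toInt (g a) ≤ 0 := fun a => by
      rw [← h.toInt_add_eq a, sub_nonpos, add_sub_assoc, le_add_iff_nonneg_right, sub_nonneg]
    have h2 : ∀ a, toInt (g a) ≤ toInt f - u ↔ u - toInt (lab a) ≤ 0 := fun a => by
      rw [← h.toInt_add_eq a, sub_nonpos, add_comm, add_sub_assoc, le_add_iff_nonneg_right,
        sub_nonneg]
    have h3 : toInt f ≤ toInt f - u ↔ u ≤ 0 := by
      rw [le_sub_self_iff]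
    have h4 : 0 ≤ toInt f - u ↔ u - toInt f ≤ 0 := by
      rw [sub_nonneg, sub_nonpos]
    simp only [h1, h2, h3, h4, sub_eq_zero] at key
    rw [if_pos hu]
    by_cases hij : i = j
    · simp only [hij, true_and, if_true, Pi.neg_apply, Pi.single_apply, ind] at key ⊢
      simp only [eq_comm (a := u)]
      linarith
    · simp only [hij, false_and, if_false, Pi.zero_apply, ind] at key ⊢
      linarith
  · rw [if_neg hu]
    split_ifs with hij
    · subst hij
      rw [Pi.neg_apply, Pi.single_eq_of_ne, neg_zero]
      rintro rfl
      exact hu (inClass_self_iff.2 h.face_mem)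
    · rfl

/-- All faces have the label of the anticanonical divisor. -/
theorem face_eq_one (h : LabelledDimer T s t α β Dv lab g f)
    (hop : LabelledDimer T t s α⁻¹ β⁻¹ (fun i => -Dv i) lab g f) (hGor : T.Gorenstein) (a : A) :
    f = 1 := by
  let j := s a
  let P := symbol s t lab g f
  let δ : (Fin d → ℤ) → ℤ := Pi.single 0 1
  have hδ : Pi.single (toInt f) 1 = act d (mono f) δ := by
    funext u
    rw [act_mono]
    simp [δ, Pi.single_apply, sub_eq_zero]
  have hp := act_det P _ _ (fun i => h.sum_act_symbol_nonneg i j) j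
  have hn := act_det P _ _ (fun i => h.sum_act_symbol_nonpos hop i j) j
  rw [sum_eq_single j (by simp +contextual) (by simp), if_pos rfl] at hp hn
  have hne : (univ : Finset (Fin d)).Nonempty := by
    by_contra hemp
    rw [univ_nonempty_iff, not_nonempty_iff] at hemp
    exact one_ne_zero (T.full_dim 1 fun ρ => hemp.elim ρ)
  obtain ⟨q, hq, hqX⟩ := isTors_coneSum T univ hne
  have hcone : coneSum T univ = (fun w => ind (InClass T Dv j j w ∧ w ≤ 0)) +
      act d (mono 1) (fun w => ind (InClass T Dv j j w ∧ 0 ≤ w)) := by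
    funext u
    have h1 : toInt (1 : Fin d → ℕ) ∈ T.prin := by
      unfold ToricData.Gorenstein at hGor
      convert hGor using 1
      funext ρ
      simp [toInt]
    have h2 : u - toInt 1 ∈ T.prin ↔ u ∈ T.prin := by
      rw [sub_eq_add_neg]
      exact T.prin.add_mem_cancel_right (T.prin.neg_mem h1)
    have h3 : 0 ≤ u - toInt 1 ↔ ∀ ρ, 0 < u ρ := by
      rw [Pi.le_def]
      refine forall_congr' fun ρ => ?_
      simp [toInt]
      omega
    rw [Pi.add_apply, act_mono]
    simp only [coneSum, inClass_self_iff, h2, h3, mem_univ, forall_const, Pi.le_def (x := u),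
      Pi.zero_apply]
    by_cases hu : u ∈ T.prin
    · simp [hu, add_comm]
    · simp [hu, ind]
  have hzero : act d (q * P.adjugate j j * (mono 1 - mono f)) δ = 0 := by
    have e : act d P.det (act d q (coneSum T univ)) = 0 := by rw [hqX, map_zero]
    rw [act_comm, hcone, map_add, act_comm _ (mono 1), hp, hn, hδ] at e
    rw [act_mul_apply, act_mul_apply, ← e]
    congr 1
    rw [map_sub, LinearMap.sub_apply, map_sub, map_neg, act_comm (mono 1)]
    abel
  have hadj : P.adjugate j j ≠ 0 := by
    have hf : f ≠ 0 := by
      rintro rfl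
      exact h.lab_ne a (le_antisymm (h.lab_le a) zero_le)
    have hc := (constCoeff d).toRingHom.map_adjugate P
    rw [constCoeff_symbol h.lab_ne h.g_ne hf, Matrix.adjugate_one] at hc
    intro h0
    have := congrFun (congrFun hc j) j
    simp [h0] at this
  have hprod := eq_zero_of_act_single_eq_zero hzero
  have hmono : mono (1 : Fin d → ℕ) = mono f :=
    sub_eq_zero.1 ((mul_eq_zero.1 hprod).resolve_left (mul_ne_zero hq hadj))
  exact ((AddMonoidAlgebra.single_left_inj one_ne_zero).1 hmono).symm

end LabelledDimer

end FaceLabel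

section Cycles

variable {A : Type} [Fintype A]

theorem sum_range_minimalPeriod {M : Type} [AddCommMonoid M] (σ : Equiv.Perm A) (ℓ : A → M)
    (a : A) : ∑ m ∈ range (Function.minimalPeriod σ a), ℓ (σ^[m] a) =
      ∑ b with σ.SameCycle a b, ℓ b := by
  have hinj : Set.InjOn (fun m => σ^[m] a) (range (Function.minimalPeriod σ a)) := by
    have := Function.iterate_injOn_Iio_minimalPeriod (f := σ) (x := a)
    simpa [Set.InjOn] using this
  rw [← sum_image (f := ℓ) hinj]
  refine sum_congr (Finset.ext fun b => ?_) fun _ _ => rfl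
  simp only [mem_image, mem_range, mem_filter, mem_univ, true_and]
  constructor
  · rintro ⟨m, -, rfl⟩
    exact ⟨m, by simp [← Equiv.Perm.iterate_eq_pow]⟩
  · intro hb
    obtain ⟨m, -, hm⟩ := hb.exists_pow_eq'
    have hpos : 0 < Function.minimalPeriod σ a :=
      Function.minimalPeriod_pos_of_mem_periodicPts
        (σ.injective.mem_periodicPts a)
    refine ⟨m % Function.minimalPeriod σ a, Nat.mod_lt _ hpos, ?_⟩
    rw [Function.iterate_mod_minimalPeriod_eq, Equiv.Perm.iterate_eq_pow, hm]

theorem sum_eq_numCycles_mul [DecidableEq A] {σ : Equiv.Perm A} (hσ : ∀ a, σ a ≠ a) {ℓ : A → ℕ}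
    {c : ℕ} (hc : ∀ a, ∑ b with σ.SameCycle a b, ℓ b = c) : ∑ a, ℓ a = numCycles σ * c := by
  have hcard : numCycles σ = #σ.cycleFactorsFinset := by
    simp [numCycles, hσ, Equiv.Perm.cycleType_def]
  have hsupp : ∀ a, a ∈ σ.support := fun a => Equiv.Perm.mem_support.2 (hσ a)
  rw [hcard, ← sum_fiberwise_of_maps_to (g := σ.cycleOf) (t := σ.cycleFactorsFinset) fun a _ =>
    Equiv.Perm.cycleOf_mem_cycleFactorsFinset_iff.2 (hsupp a), ← smul_eq_mul]
  refine sum_eq_card_nsmul fun τ hτ => ?_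
  obtain ⟨x, hx⟩ := (Equiv.Perm.mem_cycleFactorsFinset_iff.1 hτ).1.nonempty_support
  rw [← hc x, Equiv.Perm.cycle_is_cycleOf hx hτ]
  refine sum_congr (filter_congr fun a _ => ?_) fun _ _ => rfl
  rw [Equiv.Perm.sameCycle_iff_cycleOf_eq_of_mem_support (hsupp x) (hsupp a), eq_comm]

theorem two_le_minimalPeriod {σ : Equiv.Perm A} {a : A} (h : σ a ≠ a) :
    2 ≤ Function.minimalPeriod σ a := by
  have hpos : 0 < Function.minimalPeriod σ a :=
    Function.minimalPeriod_pos_of_mem_periodicPts (σ.injective.mem_periodicPts a)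
  have hne : Function.minimalPeriod σ a ≠ 1 := fun h1 =>
    h (Function.minimalPeriod_eq_one_iff_isFixedPt.1 h1)
  omega

end Cycles

section Paths

variable {V A : Type} {D : DimerStruct V A}

theorem isPathFrom_append {u w : V} {l l' : List A} :
    D.IsPathFrom u (l ++ l') w ↔ ∃ v, D.IsPathFrom u l v ∧ D.IsPathFrom v l' w := by
  induction l generalizing u with
  | nil => simp [IsPathFrom]
  | cons a l ih => simp [IsPathFrom, ih, and_assoc]

theorem isPathFrom_start_eq {u v u' v' : V} {l : List A} (hl : l ≠ [])
    (h : D.IsPathFrom u l v) (h' : D.IsPathFrom u' l v') : u = u' := by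
  obtain ⟨a, l, rfl⟩ := List.exists_cons_of_ne_nil hl
  exact h.1.symm.trans h'.1

theorem isPathFrom_end_eq {u v v' : V} {l : List A}
    (h : D.IsPathFrom u l v) (h' : D.IsPathFrom u l v') : v = v' := by
  induction l generalizing u with
  | nil => exact (h : u = v).symm.trans h'
  | cons a l ih => exact ih h.2 h'.2

/-- The path of length `k` along the orbit of a permutation, starting after `a`. -/
def orbitPath (σ : Equiv.Perm A) (a : A) (k : ℕ) : List A :=
  (List.range k).map fun m => σ^[m + 1] a

theorem isPathFrom_orbitPath {σ : Equiv.Perm A} (hσ : ∀ a, D.src (σ a) = D.tgt a) (a : A)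
    (k : ℕ) : D.IsPathFrom (D.tgt a) (orbitPath σ a k) (D.tgt (σ^[k] a)) := by
  induction k with
  | zero => rfl
  | succ k ih =>
    rw [orbitPath, List.range_succ, List.map_append, isPathFrom_append]
    refine ⟨_, ih, ?_, rfl⟩
    simp only [Function.iterate_succ_apply', hσ]

theorem isPathFrom_orbitPath_period [Fintype A] {σ : Equiv.Perm A}
    (hσ : ∀ a, D.src (σ a) = D.tgt a) {a : A} (ha : σ a ≠ a) :
    D.IsPathFrom (D.tgt a) (orbitPath σ a (Function.minimalPeriod σ a - 1)) (D.src a) := by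
  have := isPathFrom_orbitPath hσ a (Function.minimalPeriod σ a - 1)
  rwa [← hσ (σ^[_] a), ← Function.iterate_succ_apply' σ, Nat.succ_eq_add_one,
    Nat.sub_add_cancel (one_le_two.trans (two_le_minimalPeriod ha)),
    Function.iterate_minimalPeriod] at this

theorem head?_orbitPath_period [Fintype A] {σ : Equiv.Perm A} {a : A} (ha : σ a ≠ a) :
    (orbitPath σ a (Function.minimalPeriod σ a - 1)).head? = some (σ a) := by
  obtain ⟨k, hk⟩ := Nat.exists_eq_add_of_le (two_le_minimalPeriod ha)
  rw [hk, show 2 + k - 1 = k + 1 by omega]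
  simp [orbitPath, List.range_succ_eq_map]

theorem cons_orbitPath_period [Fintype A] (σ : Equiv.Perm A) (a : A) :
    a :: orbitPath σ a (Function.minimalPeriod σ a - 1) =
      (List.range (Function.minimalPeriod σ a)).map fun m => σ^[m] a := by
  have hpos : 0 < Function.minimalPeriod σ a :=
    Function.minimalPeriod_pos_of_mem_periodicPts (σ.injective.mem_periodicPts a)
  obtain ⟨k, hk⟩ := Nat.exists_eq_add_of_lt hpos
  rw [hk, zero_add, Nat.add_sub_cancel, List.range_succ_eq_map, List.map_cons, List.map_map]
  rfl

theorem orbitPath_inv_period [Fintype A] (σ : Equiv.Perm A) (a : A) :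
    orbitPath σ⁻¹ a (Function.minimalPeriod (⇑σ⁻¹) a - 1) =
      (orbitPath σ a (Function.minimalPeriod σ a - 1)).reverse := by
  have hper : Function.minimalPeriod (⇑σ⁻¹) a = Function.minimalPeriod σ a := by
    refine Function.minimalPeriod_eq_minimalPeriod_iff.2 fun n => ?_
    simp only [Function.IsPeriodicPt, Function.IsFixedPt, Equiv.Perm.iterate_eq_pow]
    rw [inv_pow, Equiv.Perm.inv_eq_iff_eq, eq_comm]
  rw [hper]
  refine List.ext_getElem (by simp [orbitPath]) fun m h1 h2 => ?_
  simp only [orbitPath, List.length_map, List.length_range] at h1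
  simp only [orbitPath, List.getElem_map, List.getElem_range, List.getElem_reverse,
    List.length_map, List.length_range, Equiv.Perm.iterate_eq_pow]
  rw [inv_pow, Equiv.Perm.inv_eq_iff_eq, ← Equiv.Perm.mul_apply, ← pow_add,
    show m + 1 + (Function.minimalPeriod σ a - 1 - 1 - m + 1) = Function.minimalPeriod σ a by omega,
    ← Equiv.Perm.iterate_eq_pow, Function.iterate_minimalPeriod]

/-- The dimer model with all arrows reversed. -/
def opposite (D : DimerStruct V A) : DimerStruct V A where
  src := D.tgt
  tgt := D.src
  nw := D.nw⁻¹
  nb := D.nb⁻¹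
  nw_src a := by rw [← D.nw_src, ← Equiv.Perm.mul_apply, mul_inv_cancel, Equiv.Perm.one_apply]
  nb_src a := by rw [← D.nb_src, ← Equiv.Perm.mul_apply, mul_inv_cancel, Equiv.Perm.one_apply]

theorem wpath_opposite [Fintype A] (a : A) : (opposite D).wpath a = (D.wpath a).reverse :=
  orbitPath_inv_period D.nw a

theorem bpath_opposite [Fintype A] (a : A) : (opposite D).bpath a = (D.bpath a).reverse :=
  orbitPath_inv_period D.nb a

theorem isPathFrom_opposite {u w : V} {l : List A} :
    (opposite D).IsPathFrom u l w ↔ D.IsPathFrom w l.reverse u := by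
  induction l generalizing u with
  | nil => simp [IsPathFrom, eq_comm]
  | cons a l ih =>
    rw [List.reverse_cons, isPathFrom_append]
    simp only [IsPathFrom, ih]
    constructor
    · rintro ⟨rfl, h⟩
      exact ⟨_, h, rfl, rfl⟩
    · rintro ⟨_, h, rfl, rfl⟩
      exact ⟨rfl, h⟩

theorem fTerm_opposite [Fintype A] {x y : V × List A} (h : FTerm D x y) (w : V) :
    FTerm (opposite D) (w, x.2.reverse) (w, y.2.reverse) := by
  induction h with
  | rel u l₁ l₂ a =>
    have := FTerm.rel (D := opposite D) w l₂.reverse l₁.reverse a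
    simpa [wpath_opposite, bpath_opposite] using this
  | refl x => exact .refl _
  | symm _ ih => exact .symm ih
  | trans _ _ ih ih' => exact .trans ih ih'

end Paths

section SectionDimer

variable {V A : Type} {d : ℕ}

/-- The label of a path. -/
def pathLab (lab : A → Fin d → ℕ) (l : List A) : Fin d → ℕ := (l.map lab).sum

theorem pathLab_nil (lab : A → Fin d → ℕ) : pathLab lab [] = 0 := rfl

theorem pathLab_cons (lab : A → Fin d → ℕ) (a : A) (l : List A) :
    pathLab lab (a :: l) = lab a + pathLab lab l := by
  simp [pathLab]

theorem pathLab_append (lab : A → Fin d → ℕ) (l l' : List A) :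
    pathLab lab (l ++ l') = pathLab lab l + pathLab lab l' := by
  simp [pathLab]

theorem pathLab_reverse (lab : A → Fin d → ℕ) (l : List A) :
    pathLab lab l.reverse = pathLab lab l := by
  simp [pathLab]

theorem toInt_add (u w : Fin d → ℕ) : toInt (u + w) = toInt u + toInt w := by
  funext ρ
  simp [toInt]

theorem toInt_zero : toInt (0 : Fin d → ℕ) = 0 := by
  funext ρ
  simp [toInt]

theorem InClass.nat_sub {T : ToricData 3 d} {Dv : V → Fin d → ℤ} {i j k : V} {u w : Fin d → ℕ}
    (hu : InClass T Dv i k (toInt u)) (hw : InClass T Dv i j (toInt w)) (hle : w ≤ u) :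
    InClass T Dv j k (toInt (u - w)) := by
  rw [← hw.add_iff, ← toInt_add, add_tsub_cancel_of_le hle]
  exact hu

/-- The quiver of a dimer model, with arrows labelled as in a quiver of sections whose paths with
equal labels are F-term equivalent. -/
structure SectionDimer (D : DimerStruct V A) (T : ToricData 3 d) (Dv : V → Fin d → ℤ)
    (lab : A → Fin d → ℕ) : Prop where
  src_ne_tgt : ∀ a, D.src a ≠ D.tgt a
  distinct : ∀ i j, InClass T Dv i j 0 → i = j
  class_lab : ∀ a, InClass T Dv (D.src a) (D.tgt a) (toInt (lab a))
  realize : ∀ i j (u : Fin d → ℕ), InClass T Dv i j (toInt u) →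
    ∃ l, D.IsPathFrom i l j ∧ pathLab lab l = u
  fTerm_iff : ∀ u w l l', D.IsPathFrom u l w → D.IsPathFrom u l' w →
    (pathLab lab l = pathLab lab l' ↔ FTerm D (u, l) (u, l'))

namespace SectionDimer

variable {D : DimerStruct V A} {T : ToricData 3 d} {Dv : V → Fin d → ℤ} {lab : A → Fin d → ℕ}

theorem nw_ne (h : SectionDimer D T Dv lab) (a : A) : D.nw a ≠ a := fun ha =>
  h.src_ne_tgt a (by rw [← D.nw_src, ha])

theorem nb_ne (h : SectionDimer D T Dv lab) (a : A) : D.nb a ≠ a := fun ha =>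
  h.src_ne_tgt a (by rw [← D.nb_src, ha])

theorem lab_le_of_head? {l : List A} {a : A} (ha : l.head? = some a) :
    lab a ≤ pathLab lab l := by
  obtain ⟨l', rfl⟩ := List.head?_eq_some_iff.1 ha
  rw [pathLab_cons]
  exact le_self_add

theorem lab_ne (h : SectionDimer D T Dv lab) (a : A) : lab a ≠ 0 := by
  intro h0
  have := h.class_lab a
  rw [h0, toInt_zero] at this
  exact h.src_ne_tgt a (h.distinct _ _ this)

theorem class_pathLab (h : SectionDimer D T Dv lab) {i j : V} {l : List A}
    (hl : D.IsPathFrom i l j) : InClass T Dv i j (toInt (pathLab lab l)) := by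
  induction l generalizing i with
  | nil =>
    obtain rfl : i = j := hl
    rw [pathLab_nil, toInt_zero, inClass_self_iff]
    exact T.prin.zero_mem
  | cons a l ih =>
    obtain ⟨rfl, hl⟩ := hl
    rw [pathLab_cons, toInt_add, (h.class_lab a).add_iff]
    exact ih hl

theorem exists_le (h : SectionDimer D T Dv lab) {i j : V} {u : Fin d → ℕ}
    (hu : InClass T Dv i j (toInt u)) (hne : ¬(i = j ∧ u = 0)) :
    ∃ a, D.src a = i ∧ lab a ≤ u := by
  obtain ⟨l, hl, rfl⟩ := h.realize i j u hu
  cases l with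
  | nil => exact absurd ⟨hl, pathLab_nil lab⟩ hne
  | cons a l => exact ⟨a, hl.1, lab_le_of_head? rfl⟩

variable [Fintype A]

theorem opposite (h : SectionDimer D T Dv lab) :
    SectionDimer (opposite D) T (fun i => -Dv i) lab where
  src_ne_tgt a := (h.src_ne_tgt a).symm
  distinct i j hij := (h.distinct j i (inClass_neg_iff.1 hij)).symm
  class_lab a := inClass_neg_iff.2 (h.class_lab a)
  realize i j u hu := by
    obtain ⟨l, hl, rfl⟩ := h.realize j i u (inClass_neg_iff.1 hu)
    exact ⟨l.reverse, isPathFrom_opposite.2 (by simpa using hl), pathLab_reverse lab l⟩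
  fTerm_iff u w l l' hl hl' := by
    rw [isPathFrom_opposite] at hl hl'
    rw [← pathLab_reverse lab l, ← pathLab_reverse lab l', h.fTerm_iff w u _ _ hl hl']
    constructor
    · intro hF
      simpa using fTerm_opposite hF u
    · exact fun hF => fTerm_opposite hF w

theorem isPathFrom_wpath (h : SectionDimer D T Dv lab) (a : A) :
    D.IsPathFrom (D.tgt a) (D.wpath a) (D.src a) :=
  isPathFrom_orbitPath_period D.nw_src (h.nw_ne a)

theorem isPathFrom_bpath (h : SectionDimer D T Dv lab) (a : A) :
    D.IsPathFrom (D.tgt a) (D.bpath a) (D.src a) :=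
  isPathFrom_orbitPath_period D.nb_src (h.nb_ne a)

theorem head?_wpath (h : SectionDimer D T Dv lab) (a : A) :
    (D.wpath a).head? = some (D.nw a) :=
  head?_orbitPath_period (h.nw_ne a)

theorem head?_bpath (h : SectionDimer D T Dv lab) (a : A) :
    (D.bpath a).head? = some (D.nb a) :=
  head?_orbitPath_period (h.nb_ne a)

theorem pathLab_bpath (h : SectionDimer D T Dv lab) (a : A) :
    pathLab lab (D.bpath a) = pathLab lab (D.wpath a) := by
  refine ((h.fTerm_iff _ _ _ _ (h.isPathFrom_wpath a) (h.isPathFrom_bpath a)).2 ?_).symm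
  simpa using FTerm.rel (D := D) (D.tgt a) [] [] a

theorem isPathFrom_iff_of_fTerm (h : SectionDimer D T Dv lab) {x y : V × List A}
    (hxy : FTerm D x y) : x.1 = y.1 ∧ pathLab lab x.2 = pathLab lab y.2 ∧
      ∀ w, D.IsPathFrom x.1 x.2 w ↔ D.IsPathFrom y.1 y.2 w := by
  induction hxy with
  | rel u l₁ l₂ a =>
    have hw : D.wpath a ≠ [] := fun h0 => by simpa [h0] using h.head?_wpath a
    have hb : D.bpath a ≠ [] := fun h0 => by simpa [h0] using h.head?_bpath a
    have key : ∀ v v', D.IsPathFrom v (D.wpath a) v' ↔ D.IsPathFrom v (D.bpath a) v' := by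
      intro v v'
      constructor
      · intro hv
        obtain rfl := isPathFrom_start_eq hw hv (h.isPathFrom_wpath a)
        obtain rfl := isPathFrom_end_eq hv (h.isPathFrom_wpath a)
        exact h.isPathFrom_bpath a
      · intro hv
        obtain rfl := isPathFrom_start_eq hb hv (h.isPathFrom_bpath a)
        obtain rfl := isPathFrom_end_eq hv (h.isPathFrom_bpath a)
        exact h.isPathFrom_wpath a
    refine ⟨rfl, by simp [pathLab_append, h.pathLab_bpath], fun w => ?_⟩
    simp [isPathFrom_append, key]
  | refl x => simp
  | symm _ ih => exact ⟨ih.1.symm, ih.2.1.symm, fun w => (ih.2.2 w).symm⟩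
  | trans _ _ ih ih' =>
    exact ⟨ih.1.trans ih'.1, ih.2.1.trans ih'.2.1, fun w => (ih.2.2 w).trans (ih'.2.2 w)⟩

theorem head?_mem_iff_of_fTerm (h : SectionDimer D T Dv lab) {S : Set A} {i j : V}
    {u : Fin d → ℕ}
    (hS : ∀ b, D.tgt b = i → pathLab lab (D.wpath b) ≤ u → (D.nw b ∈ S ↔ D.nb b ∈ S))
    {x y : V × List A} (hxy : FTerm D x y) (hx : x.1 = i) (hxu : pathLab lab x.2 = u)
    (hxj : D.IsPathFrom x.1 x.2 j) :
    (∃ a ∈ S, x.2.head? = some a) ↔ ∃ a ∈ S, y.2.head? = some a := by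
  induction hxy with
  | rel v l₁ l₂ a =>
    subst hx
    rcases l₁ with - | ⟨b, l₁⟩
    · simp only [List.nil_append, List.head?_append, h.head?_wpath, h.head?_bpath,
        Option.some_or, Option.some_inj, exists_eq_right'] at hxj hxu ⊢
      obtain ⟨v', hv', -⟩ := isPathFrom_append.1 hxj
      have hw : D.wpath a ≠ [] := fun h0 => by simpa [h0] using h.head?_wpath a
      refine hS a (isPathFrom_start_eq hw (h.isPathFrom_wpath a) hv') ?_
      rw [← hxu, pathLab_append]
      exact le_self_add
    · simp
  | refl x => rfl
  | symm hxy ih =>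
    obtain ⟨h1, h2, h3⟩ := h.isPathFrom_iff_of_fTerm hxy
    exact (ih (h1.trans hx) (h2.trans hxu) ((h3 j).2 hxj)).symm
  | trans hxy _ ih ih' =>
    obtain ⟨h1, h2, h3⟩ := h.isPathFrom_iff_of_fTerm hxy
    exact (ih hx hxu hxj).trans (ih' (h1.symm.trans hx) (h2.symm.trans hxu) ((h3 j).1 hxj))

theorem connected (h : SectionDimer D T Dv lab) {i j : V} {u : Fin d → ℕ}
    (hu : InClass T Dv i j (toInt u)) (S : Set A)
    (hS : ∀ b, D.tgt b = i → pathLab lab (D.wpath b) ≤ u → (D.nw b ∈ S ↔ D.nb b ∈ S))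
    {a a' : A} (ha : D.src a = i) (ha' : D.src a' = i) (hau : lab a ≤ u) (hau' : lab a' ≤ u) :
    a ∈ S ↔ a' ∈ S := by
  have key : ∀ b, D.src b = i → lab b ≤ u →
      ∃ l, D.IsPathFrom i (b :: l) j ∧ pathLab lab (b :: l) = u := by
    rintro b rfl hb
    obtain ⟨l, hl, hlu⟩ := h.realize _ _ _ (hu.nat_sub (h.class_lab b) hb)
    exact ⟨l, ⟨rfl, hl⟩, by rw [pathLab_cons, hlu, add_tsub_cancel_of_le hb]⟩
  obtain ⟨l, hl, hlu⟩ := key a ha hau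
  obtain ⟨l', hl', hlu'⟩ := key a' ha' hau'
  have hF := (h.fTerm_iff _ _ _ _ hl hl').1 (hlu.trans hlu'.symm)
  simpa using h.head?_mem_iff_of_fTerm hS hF rfl hlu hl

theorem lab_add_pathLab_wpath (a : A) :
    lab a + pathLab lab (D.wpath a) = ∑ b with D.nw.SameCycle a b, lab b := by
  rw [← pathLab_cons, ← sum_range_minimalPeriod]
  refine (congrArg (pathLab lab) (cons_orbitPath_period D.nw a)).trans ?_
  rw [pathLab, List.map_map]
  rfl

theorem lab_add_pathLab_bpath (a : A) :
    lab a + pathLab lab (D.bpath a) = ∑ b with D.nb.SameCycle a b, lab b := by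
  rw [← pathLab_cons, ← sum_range_minimalPeriod]
  refine (congrArg (pathLab lab) (cons_orbitPath_period D.nb a)).trans ?_
  rw [pathLab, List.map_map]
  rfl

theorem face_nw (a : A) : lab (D.nw a) + pathLab lab (D.wpath (D.nw a)) =
    lab a + pathLab lab (D.wpath a) := by
  simp [lab_add_pathLab_wpath]

theorem face_nb (h : SectionDimer D T Dv lab) (a : A) :
    lab (D.nb a) + pathLab lab (D.wpath (D.nb a)) = lab a + pathLab lab (D.wpath a) := by
  simp [← h.pathLab_bpath, lab_add_pathLab_bpath]

theorem face_eq_of_src_eq (h : SectionDimer D T Dv lab) {a a' : A} (haa : D.src a = D.src a') :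
    lab a + pathLab lab (D.wpath a) = lab a' + pathLab lab (D.wpath a') := by
  obtain ⟨u, hu, hle⟩ := LabelledDimer.exists_nat_ge T (lab a + lab a')
  exact (h.connected (i := D.src a') (inClass_self_iff.2 hu)
    {b | lab b + pathLab lab (D.wpath b) = lab a' + pathLab lab (D.wpath a')}
    (fun b _ _ => by simp [face_nw, h.face_nb]) haa rfl (le_self_add.trans hle)
    (le_add_self.trans hle)).2 rfl

theorem face_eq_of_isPathFrom (h : SectionDimer D T Dv lab) {l : List A} {a a' : A}
    (hl : D.IsPathFrom (D.tgt a) l (D.src a')) :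
    lab a + pathLab lab (D.wpath a) = lab a' + pathLab lab (D.wpath a') := by
  induction l generalizing a with
  | nil =>
    rw [← face_nw a]
    exact h.face_eq_of_src_eq ((D.nw_src a).trans hl)
  | cons b l ih =>
    rw [← ih hl.2, ← face_nw a]
    exact h.face_eq_of_src_eq ((D.nw_src a).trans hl.1.symm)

theorem face_eq (h : SectionDimer D T Dv lab) (a a' : A) :
    lab a + pathLab lab (D.wpath a) = lab a' + pathLab lab (D.wpath a') := by
  let w := Dv (D.src a') - Dv (D.tgt a)
  obtain ⟨u, hu, hle⟩ := LabelledDimer.exists_nat_ge T fun ρ => (-w ρ).toNat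
  have hnn : toInt (fun ρ => (toInt u ρ + w ρ).toNat) = toInt u + w := by
    funext ρ
    have := hle ρ
    simp only [toInt, Pi.add_apply] at this ⊢
    omega
  have hcl : InClass T Dv (D.tgt a) (D.src a') (toInt fun ρ => (toInt u ρ + w ρ).toNat) := by
    rw [hnn, InClass, add_sub_cancel_right]
    exact hu
  obtain ⟨l, hl, -⟩ := h.realize _ _ _ hcl
  exact h.face_eq_of_isPathFrom hl

/-- The sum of the labels around each white or black face equals the label of any face. -/
theorem sum_sameCycle_eq (h : SectionDimer D T Dv lab) {f : Fin d → ℕ}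
    (hf : ∀ a, lab a + pathLab lab (D.wpath a) = f) (a : A) (ρ : Fin d) :
    ∑ b with D.nw.SameCycle a b, lab b ρ = f ρ ∧ ∑ b with D.nb.SameCycle a b, lab b ρ = f ρ := by
  constructor
  · rw [← hf a, lab_add_pathLab_wpath, Finset.sum_apply]
  · rw [← hf a, ← h.pathLab_bpath, lab_add_pathLab_bpath, Finset.sum_apply]

theorem labelledDimer [Fintype V] (h : SectionDimer D T Dv lab) {f : Fin d → ℕ}
    (hf : ∀ a, lab a + pathLab lab (D.wpath a) = f) (a₀ : A)
    (heuler : ∀ ρ, Fintype.card V * f ρ + 2 * ∑ a, lab a ρ = Fintype.card A * f ρ) :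
    LabelledDimer T D.src D.tgt D.nw D.nb Dv lab (fun a => pathLab lab (D.wpath a)) f where
  src_α := D.nw_src
  src_β := D.nb_src
  add_eq := hf
  lab_α b := lab_le_of_head? (h.head?_wpath b)
  lab_β b := (lab_le_of_head? (h.head?_bpath b)).trans_eq (h.pathLab_bpath b)
  lab_ne := h.lab_ne
  distinct := h.distinct
  class_lab := h.class_lab
  face_mem := by
    rw [← inClass_self_iff (Dv := Dv) (i := D.src a₀), ← hf a₀, toInt_add,
      (h.class_lab a₀).add_iff]
    exact h.class_pathLab (h.isPathFrom_wpath a₀)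
  exists_le _ _ _ hu hne := h.exists_le hu hne
  connected _ _ _ hu S hS _ _ := h.connected hu S hS
  euler := heuler

/-- In a dimer model on the torus, every face has the anticanonical label. -/
theorem face_eq_one [Fintype V] [DecidableEq A] (h : SectionDimer D T Dv lab)
    (hGor : T.Gorenstein)
    (heuler : Fintype.card V + (numCycles D.nw + numCycles D.nb) = Fintype.card A) (a : A) :
    lab a + pathLab lab (D.wpath a) = 1 := by
  have hf : ∀ a', lab a' + pathLab lab (D.wpath a') = lab a + pathLab lab (D.wpath a) :=
    fun a' => h.face_eq a' a
  generalize lab a + pathLab lab (D.wpath a) = f at hf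
  have hsum : ∀ ρ, Fintype.card V * f ρ + 2 * ∑ a, lab a ρ = Fintype.card A * f ρ := by
    intro ρ
    have h1 := sum_eq_numCycles_mul h.nw_ne (ℓ := fun a => lab a ρ) (c := f ρ) fun a => by
      convert (h.sum_sameCycle_eq hf a ρ).1
    have h2 := sum_eq_numCycles_mul h.nb_ne (ℓ := fun a => lab a ρ) (c := f ρ) fun a => by
      convert (h.sum_sameCycle_eq hf a ρ).2
    rw [← heuler, add_mul, add_mul, ← h1, ← h2, two_mul]
  have hg : ∀ a, pathLab lab ((DimerLabel.opposite D).wpath a) = pathLab lab (D.wpath a) :=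
    fun a => by rw [wpath_opposite, pathLab_reverse]
  have hop := h.opposite.labelledDimer (f := f) (fun a => by rw [hg, hf]) a hsum
  simp only [hg] at hop
  exact (h.labelledDimer hf a hsum).face_eq_one hop hGor a

end SectionDimer

end SectionDimer

section Collection

variable {V A : Type} {d : ℕ} {T : ToricData 3 d} {C : Collection T V}

theorem eq_of_isSection_zero {i j : V} (h : C.IsSection i j 0) : i = j := by
  refine C.distinct i j ?_
  rw [Collection.IsSection, toInt_zero] at h
  simpa using h

/-- Every section is the label of a path in the quiver of sections. -/
theorem exists_path_of_isSection {D : DimerStruct V A} (φ : A ≃ C.Arrow)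
    (hφ : ∀ a, (φ a).src = D.src a ∧ (φ a).tgt = D.tgt a) {i j : V} {u : Fin d → ℕ}
    (hu : C.IsSection i j u) :
    ∃ l, D.IsPathFrom i l j ∧ pathLab (fun a => (φ a).lab) l = u := by
  induction hn : ∑ ρ, u ρ using Nat.strong_induction_on generalizing i j u with
  | h n ih =>
    subst hn
    by_cases h0 : i = j ∧ u = 0
    · exact ⟨[], h0.1, h0.2.symm⟩
    by_cases hirr : C.IsIrreducible i j u
    · obtain ⟨h1, h2⟩ := hφ (φ.symm ⟨i, j, u, hirr, h0⟩)
      rw [Equiv.apply_symm_apply] at h1 h2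
      exact ⟨[φ.symm ⟨i, j, u, hirr, h0⟩], ⟨h1.symm, h2.symm⟩, by simp [pathLab]⟩
    · simp only [Collection.IsIrreducible, hu, true_and, not_forall, not_or] at hirr
      obtain ⟨k, u₁, u₂, rfl, hs₂, hs₁, hn₂, hn₁⟩ := hirr
      have pos : ∀ w : Fin d → ℕ, w ≠ 0 → 0 < ∑ ρ, w ρ := by
        intro w hw
        obtain ⟨ρ, hρ⟩ := Function.ne_iff.1 hw
        exact sum_pos' (fun _ _ => Nat.zero_le _) ⟨ρ, mem_univ ρ, Nat.pos_of_ne_zero hρ⟩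
      have p₁ := pos u₁ fun h => hn₁ ⟨eq_of_isSection_zero (h ▸ hs₁), h⟩
      have p₂ := pos u₂ fun h => hn₂ ⟨(eq_of_isSection_zero (h ▸ hs₂)).symm, h⟩
      have hadd : ∑ ρ, (u₁ + u₂) ρ = ∑ ρ, u₁ ρ + ∑ ρ, u₂ ρ := by simp [sum_add_distrib]
      obtain ⟨l₁, hl₁, e₁⟩ := ih _ (by omega) hs₁ rfl
      obtain ⟨l₂, hl₂, e₂⟩ := ih _ (by omega) hs₂ rfl
      exact ⟨l₂ ++ l₁, isPathFrom_append.2 ⟨k, hl₂, hl₁⟩, by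
        rw [pathLab_append, e₁, e₂, add_comm]⟩

theorem labSum_eq_pathLab (φ : A ≃ C.Arrow) (l : List A) :
    labSum φ l = pathLab (fun a => (φ a).lab) l := by
  funext ρ
  induction l with
  | nil => rfl
  | cons a l ih =>
    rw [pathLab_cons, Pi.add_apply, ← ih]
    simp [labSum]

theorem sectionDimer {D : DimerStruct V A} (φ : A ≃ C.Arrow)
    (hφ : ∀ a, (φ a).src = D.src a ∧ (φ a).tgt = D.tgt a) (hne : ∀ a, D.src a ≠ D.tgt a)
    (hiso : ∀ (u w : V) (l l' : List A), D.IsPathFrom u l w → D.IsPathFrom u l' w →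
      (labSum φ l = labSum φ l' ↔ FTerm D (u, l) (u, l'))) :
    SectionDimer D T C.D fun a => (φ a).lab where
  src_ne_tgt := hne
  distinct i j hij := eq_of_isSection_zero (C := C) (by
    rw [Collection.IsSection, toInt_zero]
    exact hij)
  class_lab a := by
    rw [← (hφ a).1, ← (hφ a).2]
    exact (φ a).irred.1
  realize i j u hu := exists_path_of_isSection φ hφ hu
  fTerm_iff u w l l' hl hl' := by
    rw [← labSum_eq_pathLab, ← labSum_eq_pathLab]
    exact hiso u w l l' hl hl'

theorem existsUnique_pos_of_sum_eq_one [Fintype A] {p : A → Prop} {_ : DecidablePred p}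
    {ℓ : A → ℕ}
    (h : ∑ b with p b, ℓ b = 1) : ∃! b, p b ∧ 0 < ℓ b := by
  obtain ⟨b, hb, hb0⟩ := exists_ne_zero_of_sum_ne_zero (h.trans_ne one_ne_zero)
  refine ⟨b, ⟨(mem_filter.1 hb).2, Nat.pos_of_ne_zero hb0⟩, fun b' hb' => ?_⟩
  by_contra hne
  have hle : ∑ c ∈ {b', b}, ℓ c ≤ ∑ c with p c, ℓ c := by
    refine sum_le_sum_of_subset fun c hc => ?_
    rcases mem_insert.1 hc with rfl | hc
    · simpa using hb'.1
    · rwa [mem_singleton.1 hc]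
  rw [sum_pair hne, h] at hle
  have := hb'.2
  omega

end Collection

end DimerLabel

/-- Proposition 5.3: let `Q` be the quiver arising from an
algebraically consistent dimer model `Γ`, viewed as the quiver of sections of the
collection `𝓔` on `X = Spec Z(A_Γ)`.  Then every arrow `a ∈ Q₁` satisfies
`x^{div a} = Π_{ρ ∈ σ(1), a ∈ supp Π_ρ} x_ρ`: the labelling monomial of `a` is the
squarefree product of the Cox variables of exactly those rays `ρ` whose (unique)
corresponding perfect matching `Π_ρ` of `Γ` contains `a`.  Concretely: each exponent
`div(a)_ρ` is `0` or `1`, and for each ray `ρ` the support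
`supp Π_ρ = {a : div(a)_ρ > 0}` is a perfect matching of the dimer model `Γ`
(`a ∈ supp Π_ρ ↔ x_ρ ∣ x^{div a}` holds by definition of `Π_ρ = π₂^*(χ_ρ)`). -/
theorem dimer_arrow_label_eq_product_of_matchings
    {V A : Type} [Fintype V] [Fintype A] [DecidableEq V] [DecidableEq A]
    (D : DimerStruct V A) (htor : D.IsTorusDimer) (hcon : D.AlgConsistent)
    {d : ℕ} (T : ToricData 3 d) (hGor : T.Gorenstein)
    (C : Collection T V)
    (φ : A ≃ C.Arrow)
    (hφ : ∀ a : A, (φ a).src = D.src a ∧ (φ a).tgt = D.tgt a)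
    (hiso : ∀ (u w : V) (l l' : List A), D.IsPathFrom u l w → D.IsPathFrom u l' w →
      (labSum φ l = labSum φ l' ↔ FTerm D (u, l) (u, l'))) :
    (∀ (a : A) (ρ : Fin d), (φ a).lab ρ = 0 ∨ (φ a).lab ρ = 1)
    ∧ (∀ ρ : Fin d, D.IsPerfectMatching {a : A | 0 < (φ a).lab ρ}) := by
  have h := DimerLabel.sectionDimer φ hφ htor.2.2.1 hiso
  have hone := h.face_eq_one hGor htor.1
  have hsum := fun a ρ => h.sum_sameCycle_eq hone a ρ
  refine ⟨fun a ρ => ?_, fun ρ => ⟨fun a => ?_, fun a => ?_⟩⟩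
  · have hle : (φ a).lab ρ ≤ 1 := by
      have := congrFun (hone a) ρ
      simp only [Pi.add_apply, Pi.one_apply] at this
      omega
    omega
  · exact DimerLabel.existsUnique_pos_of_sum_eq_one (hsum a ρ).1
  · exact DimerLabel.existsUnique_pos_of_sum_eq_one (hsum a ρ).2
end

section
/- For any algebraically consistent dimer model Γ with associated quiver Q and for any arrow a ∈ Q₁, the labelling monomial x^{div(a)} divides ∏_{ρ∈σ(1)} x_ρ; equivalently, ⟨Π_ρ, π(χ_a)⟩ ∈ {0,1} for every extremal perfect matching Π_ρ. -/
open NCCell DimerStruct Collection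

section CycleSums

variable {A : Type} [Fintype A] [DecidableEq A]

/-- The cycle of the permutation `σ` through `a`, as a finite set. -/
def cycleFinset (σ : Equiv.Perm A) (a : A) : Finset A :=
  Finset.univ.filter fun b => σ.SameCycle a b

lemma mem_cycleFinset {σ : Equiv.Perm A} {a b : A} :
    b ∈ cycleFinset σ a ↔ σ.SameCycle a b := by
  simp [cycleFinset]

lemma self_mem_cycleFinset (σ : Equiv.Perm A) (a : A) : a ∈ cycleFinset σ a :=
  mem_cycleFinset.2 (Equiv.Perm.SameCycle.refl σ a)

lemma cycleFinset_apply (σ : Equiv.Perm A) (a : A) : cycleFinset σ (σ a) = cycleFinset σ a := by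
  ext b
  simp [mem_cycleFinset]

lemma sum_cycleFinset_comp {M : Type*} [AddCommMonoid M] (σ : Equiv.Perm A) (a : A) (g : A → M) :
    ∑ b ∈ cycleFinset σ a, g (σ b) = ∑ b ∈ cycleFinset σ a, g b :=
  Finset.sum_equiv σ (by simp [mem_cycleFinset]) (by simp)

lemma minimalPeriod_perm_pos {A : Type} [Finite A] (σ : Equiv.Perm A) (a : A) :
    0 < Function.minimalPeriod (⇑σ) a :=
  Function.minimalPeriod_pos_of_mem_periodicPts
    (Function.Injective.mem_periodicPts σ.injective a)

lemma cons_orbit_eq {A : Type} [Finite A] (σ : Equiv.Perm A) (a : A) :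
    a :: (List.range (Function.minimalPeriod (⇑σ) a - 1)).map (fun m => (⇑σ)^[m + 1] a) =
      (List.range (Function.minimalPeriod (⇑σ) a)).map fun m => (⇑σ)^[m] a := by
  obtain ⟨k, hk⟩ := Nat.exists_eq_succ_of_ne_zero (minimalPeriod_perm_pos σ a).ne'
  rw [hk, List.range_succ_eq_map]
  simp [Function.comp_def]

lemma sum_orbit_eq {M : Type*} [AddCommMonoid M] (σ : Equiv.Perm A) (a : A) (g : A → M) :
    ((a :: (List.range (Function.minimalPeriod (⇑σ) a - 1)).map
      (fun m => (⇑σ)^[m + 1] a)).map g).sum = ∑ b ∈ cycleFinset σ a, g b := by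
  rw [cons_orbit_eq]
  have hnd : ((List.range (Function.minimalPeriod (⇑σ) a)).map fun m => (⇑σ)^[m] a).Nodup :=
    Function.nodup_periodicOrbit (f := ⇑σ) (x := a)
  rw [← List.sum_toFinset g hnd]
  refine Finset.sum_congr ?_ fun _ _ => rfl
  ext b
  simp only [List.mem_toFinset, List.mem_map, List.mem_range, mem_cycleFinset]
  constructor
  · rintro ⟨m, -, rfl⟩
    rw [← Equiv.Perm.coe_pow]
    exact Equiv.Perm.sameCycle_pow_right.2 (Equiv.Perm.SameCycle.refl σ a)
  · intro h
    obtain ⟨i, -, hi⟩ := h.exists_pow_eq'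
    refine ⟨i % Function.minimalPeriod (⇑σ) a, Nat.mod_lt _ (minimalPeriod_perm_pos σ a), ?_⟩
    rw [Function.iterate_mod_minimalPeriod_eq, ← hi, Equiv.Perm.coe_pow]

lemma mul_numCycles_le_sum (σ : Equiv.Perm A) (f : A → ℕ) (k : ℕ)
    (h : ∀ a, k ≤ ∑ b ∈ cycleFinset σ a, f b) :
    k * numCycles σ ≤ ∑ a, f a := by
  have hcyc : k * Multiset.card σ.cycleType ≤ ∑ a ∈ σ.support, f a := by
    have hdis : (σ.cycleFactorsFinset : Set (Equiv.Perm A)).PairwiseDisjoint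
        Equiv.Perm.support := fun c hc c' hc' hne =>
      (σ.cycleFactorsFinset_pairwise_disjoint hc hc' hne).disjoint_support
    have hsub : σ.cycleFactorsFinset.biUnion Equiv.Perm.support ⊆ σ.support := by
      intro x hx
      obtain ⟨c, hc, hx⟩ := Finset.mem_biUnion.1 hx
      exact Equiv.Perm.mem_cycleFactorsFinset_support_le hc hx
    calc k * Multiset.card σ.cycleType = ∑ _c ∈ σ.cycleFactorsFinset, k := by
          simp [Equiv.Perm.cycleType_def, mul_comm]
      _ ≤ ∑ c ∈ σ.cycleFactorsFinset, ∑ a ∈ c.support, f a := by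
          refine Finset.sum_le_sum fun c hc => ?_
          obtain ⟨x, hx⟩ := (Equiv.Perm.mem_cycleFactorsFinset_iff.1 hc).1.nonempty_support
          refine (h x).trans (Finset.sum_le_sum_of_subset fun b hb => ?_)
          rw [Equiv.Perm.cycle_is_cycleOf hx hc, Equiv.Perm.mem_support_cycleOf_iff]
          exact ⟨mem_cycleFinset.1 hb, Equiv.Perm.mem_cycleFactorsFinset_support_le hc hx⟩
      _ = ∑ a ∈ σ.cycleFactorsFinset.biUnion Equiv.Perm.support, f a :=
          (Finset.sum_biUnion hdis).symm
      _ ≤ ∑ a ∈ σ.support, f a := Finset.sum_le_sum_of_subset hsub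
  have hfix : k * (Finset.univ.filter fun a => σ a = a).card ≤
      ∑ a ∈ Finset.univ.filter (fun a => σ a = a), f a := by
    rw [mul_comm, ← smul_eq_mul]
    refine Finset.card_nsmul_le_sum _ _ _ fun a ha => (h a).trans ?_
    have : cycleFinset σ a ⊆ {a} := by
      intro b hb
      obtain ⟨i, hi⟩ := mem_cycleFinset.1 hb
      rw [Equiv.Perm.zpow_apply_eq_self_of_apply_eq_self (Finset.mem_filter.1 ha).2] at hi
      simp [hi]
    simpa using Finset.sum_le_sum_of_subset (f := f) this
  have hsplit : ∑ a, f a = ∑ a ∈ σ.support, f a +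
      ∑ a ∈ Finset.univ.filter (fun a => σ a = a), f a := by
    rw [← Finset.sum_filter_add_sum_filter_not Finset.univ (fun a => σ a ≠ a)]
    simp [Equiv.Perm.support]
  rw [hsplit, numCycles, mul_add]
  exact add_le_add hcyc hfix

end CycleSums

section WeightedCycles

variable {A : Type} [Fintype A] [DecidableEq A]

lemma eq_of_mem_cycle_of_eq_sum {σ : Equiv.Perm A} {ℓ : A → ℕ} {ω : ℕ} {a b : A}
    (hσ : ∑ e ∈ cycleFinset σ a, ℓ e = ω) (ha : ℓ a = ω) (hb : ℓ b ≠ 0)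
    (hab : b ∈ cycleFinset σ a) : b = a := by
  by_contra hne
  have := Finset.add_le_sum (f := ℓ) (fun _ _ => Nat.zero_le _) hab
    (self_mem_cycleFinset σ a) hne
  omega

lemma two_le_sum_cycle {σ : Equiv.Perm A} {ℓ : A → ℕ} {ω : ℕ} (hω : 0 < ω) {a : A}
    (hσ : ∑ e ∈ cycleFinset σ a, ℓ e = ω) :
    2 ≤ ∑ e ∈ cycleFinset σ a, (if ℓ e = ω then 2 else if ℓ e = 0 then 0 else 1) := by
  set w : A → ℕ := fun e => if ℓ e = ω then 2 else if ℓ e = 0 then 0 else 1 with hw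
  change 2 ≤ ∑ e ∈ cycleFinset σ a, w e
  obtain ⟨x, hx, hx0⟩ := Finset.exists_ne_zero_of_sum_ne_zero (hσ.trans_ne hω.ne')
  by_cases hxω : ℓ x = ω
  · have := Finset.single_le_sum (f := w) (fun _ _ => Nat.zero_le _) hx
    simp only [hw, hxω, if_true] at this
    exact this
  · have herase := Finset.add_sum_erase _ ℓ hx
    have hne : ∑ e ∈ (cycleFinset σ a).erase x, ℓ e ≠ 0 := by omega
    obtain ⟨y, hy, hy0⟩ := Finset.exists_ne_zero_of_sum_ne_zero hne
    obtain ⟨hyx, hy⟩ := Finset.mem_erase.1 hy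
    have := Finset.add_le_sum (f := w) (fun _ _ => Nat.zero_le _) hx hy hyx.symm
    have hwx : 1 ≤ w x := by simp [hw, hxω, hx0]
    have hwy : 1 ≤ w y := by simp only [hw]; split_ifs <;> omega
    omega

/-- Consider two permutations of a finite set `A` and a weight that sums to `ω` on each of
their cycles.  If a torus-like Euler characteristic condition holds, and a space `E` of
functions with equal sums over the two cycles through each element is large enough, then
the weight takes only the values `0` and `ω`. -/
theorem weight_eq_zero_or_eq_total {σ τ : Equiv.Perm A} {ℓ : A → ℕ} {ω nV : ℕ} (hω : 0 < ω)
    (hσ : ∀ a, ∑ e ∈ cycleFinset σ a, ℓ e = ω) (hτ : ∀ a, ∑ e ∈ cycleFinset τ a, ℓ e = ω)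
    (heuler : nV + (numCycles σ + numCycles τ) = Fintype.card A)
    (hconn : ∀ f : A → ℚ, (∀ a, f (σ a) = f a) → (∀ a, f (τ a) = f a) → ∀ a b, f a = f b)
    {E : Type} [AddCommGroup E] [Module ℚ E]
    (hE : nV + 3 ≤ Module.finrank ℚ E) (Ψ : E →ₗ[ℚ] A → ℚ)
    (hΨ : ∀ x b, ∑ e ∈ cycleFinset σ b, Ψ x e = ∑ e ∈ cycleFinset τ b, Ψ x e)
    (g : E →ₗ[ℚ] ℚ × ℚ) (hinj : ∀ x, (∀ a, ℓ a = 0 → Ψ x a = 0) → g x = 0 → x = 0) (a : A) :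
    ℓ a = 0 ∨ ℓ a = ω := by
  classical
  by_contra! ha
  let A0 := {a : A // ℓ a = 0}
  let Aω := {a : A // ℓ a = ω}
  have hcount : Fintype.card A0 ≤ Fintype.card Aω + nV := by
    let w : A → ℕ := fun e => if ℓ e = ω then 2 else if ℓ e = 0 then 0 else 1
    have h1 := mul_numCycles_le_sum σ w 2 fun a => two_le_sum_cycle hω (hσ a)
    have h2 := mul_numCycles_le_sum τ w 2 fun a => two_le_sum_cycle hω (hτ a)
    have h3 : ∑ a, w a + Fintype.card A0 = Fintype.card A + Fintype.card Aω := by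
      rw [Fintype.card_subtype, Fintype.card_subtype, Finset.card_filter, Finset.card_filter,
        Fintype.card_eq_sum_ones, ← Finset.sum_add_distrib, ← Finset.sum_add_distrib]
      refine Finset.sum_congr rfl fun e _ => ?_
      simp only [w]
      split_ifs <;> omega
    omega
  let r : (A → ℚ) →ₗ[ℚ] A0 → ℚ := LinearMap.funLeft ℚ ℚ Subtype.val
  let ext0 : (A0 → ℚ) →ₗ[ℚ] A → ℚ := LinearMap.pi fun e =>
    if h : ℓ e = 0 then LinearMap.proj (⟨e, h⟩ : A0) else 0
  have hext0 : ∀ (y : A0 → ℚ) (e : A), ext0 y e = if h : ℓ e = 0 then y ⟨e, h⟩ else 0 := by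
    intro y e
    simp only [ext0, LinearMap.pi_apply]
    split_ifs <;> rfl
  let S : (A0 → ℚ) →ₗ[ℚ] Aω → ℚ := LinearMap.pi fun b =>
    (∑ e ∈ cycleFinset σ b.1, LinearMap.proj e - ∑ e ∈ cycleFinset τ b.1, LinearMap.proj e) ∘ₗ ext0
  have hS : ∀ y b, S y b =
      ∑ e ∈ cycleFinset σ b.1, ext0 y e - ∑ e ∈ cycleFinset τ b.1, ext0 y e := by
    intro y b
    simp [S]
  have hSΨ : ∀ x, S (r (Ψ x)) = 0 := by
    intro x
    ext b
    have key : ∀ κ : Equiv.Perm A, (∑ e ∈ cycleFinset κ b.1, ℓ e = ω) →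
        ∑ e ∈ cycleFinset κ b.1, ext0 (r (Ψ x)) e = ∑ e ∈ cycleFinset κ b.1, Ψ x e - Ψ x b.1 := by
      intro κ hκ
      rw [← Finset.add_sum_erase _ _ (self_mem_cycleFinset κ b.1),
        ← Finset.add_sum_erase _ (Ψ x) (self_mem_cycleFinset κ b.1), hext0,
        dif_neg (b.2.trans_ne hω.ne'), zero_add, add_sub_cancel_left]
      refine Finset.sum_congr rfl fun e he => ?_
      obtain ⟨hne, he⟩ := Finset.mem_erase.1 he
      have h0 : ℓ e = 0 := by
        by_contra h0
        exact hne (eq_of_mem_cycle_of_eq_sum hκ b.2 h0 he)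
      rw [hext0, dif_pos h0]
      rfl
    rw [hS, key σ (hσ _), key τ (hτ _), hΨ]
    simp
  have hnsurj : ¬ Function.Surjective S := by
    intro hsurj
    let Θ : E →ₗ[ℚ] LinearMap.ker S × (ℚ × ℚ) :=
      ((r ∘ₗ Ψ).codRestrict (LinearMap.ker S) hSΨ).prod g
    have hΘ : Function.Injective Θ := by
      rw [← LinearMap.ker_eq_bot, LinearMap.ker_eq_bot']
      intro x hx
      obtain ⟨h1, h2⟩ := Prod.mk.inj hx
      refine hinj x (fun a ha => ?_) h2
      exact congrFun (congrArg Subtype.val h1) ⟨a, ha⟩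
    have h1 := LinearMap.finrank_le_finrank_of_injective hΘ
    have h2 := LinearMap.finrank_range_add_finrank_ker S
    rw [LinearMap.range_eq_top.2 hsurj, finrank_top, Module.finrank_fintype_fun_eq_card,
      Module.finrank_fintype_fun_eq_card] at h2
    simp only [Module.finrank_prod, Module.finrank_self] at h1
    omega
  obtain ⟨c, hc0, hc⟩ : ∃ c : Aω → ℚ, c ≠ 0 ∧ ∀ y, ∑ b, c b * S y b = 0 := by
    have hlt : LinearMap.range S < ⊤ := lt_top_iff_ne_top.2 fun h =>
      hnsurj (LinearMap.range_eq_top.1 h)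
    obtain ⟨F, hF0, hF⟩ := Submodule.exists_le_ker_of_lt_top _ hlt
    have hFsum : ∀ z : Aω → ℚ, ∑ b, F (Pi.single b 1) * z b = F z := by
      intro z
      conv_rhs => rw [pi_eq_sum_univ' z, map_sum]
      refine Finset.sum_congr rfl fun b _ => ?_
      rw [map_smul, smul_eq_mul, mul_comm]
    refine ⟨fun b => F (Pi.single b 1), fun h => hF0 (LinearMap.ext fun z => ?_), fun y => ?_⟩
    · rw [← hFsum z]
      simp [congrFun h]
    · rw [hFsum]
      exact hF ⟨y, rfl⟩
  let c' : A → ℚ := fun e => if h : ℓ e = ω then c ⟨e, h⟩ else 0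
  have hc'sum : ∀ f : A → ℚ, ∑ b : Aω, c b * f b.1 = ∑ b, c' b * f b := by
    intro f
    calc ∑ b : Aω, c b * f b.1 = ∑ b : Aω, c' b.1 * f b.1 :=
          Finset.sum_congr rfl fun b _ => by simp only [c', dif_pos b.2]; rfl
      _ = ∑ b ∈ Finset.univ.filter (fun b => ℓ b = ω), c' b * f b :=
          (Finset.sum_subtype _ (by simp) fun b => c' b * f b).symm
      _ = ∑ b, c' b * f b := by
          refine Finset.sum_filter_of_ne fun b _ hb => ?_
          by_contra h
          exact hb (by simp only [c', dif_neg h, zero_mul])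
  let cF : Equiv.Perm A → A → ℚ := fun κ a => ∑ b ∈ cycleFinset κ a, c' b
  have hcF : ∀ κ : Equiv.Perm A, (∀ a, ∑ e ∈ cycleFinset κ a, ℓ e = ω) → ∀ a, ℓ a ≠ 0 →
      cF κ a = c' a := by
    intro κ hκ a ha
    refine Finset.sum_eq_single_of_mem a (self_mem_cycleFinset κ a) fun b hb hba => ?_
    by_contra hcb
    have hbω : ℓ b = ω := by
      by_contra h
      exact hcb (dif_neg h)
    refine hba (eq_of_mem_cycle_of_eq_sum (hκ b) hbω ha ?_).symm
    exact mem_cycleFinset.2 (mem_cycleFinset.1 hb).symm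
  have hcFeq : cF σ = cF τ := by
    ext e
    by_cases he : ℓ e = 0
    · have := hc (Pi.single ⟨e, he⟩ 1)
      have hsingle : ∀ x, ext0 (Pi.single ⟨e, he⟩ 1) x = if e = x then 1 else 0 := by
        intro x
        rw [hext0]
        by_cases hx : e = x
        · subst hx
          simp [he]
        · have hne : ∀ h : ℓ x = 0, (⟨x, h⟩ : A0) ≠ ⟨e, he⟩ := fun h h' =>
            hx (congrArg Subtype.val h').symm
          simp [hx, hne]
      have key : ∀ κ : Equiv.Perm A, cF κ e =
          ∑ b, c' b * ∑ x ∈ cycleFinset κ b, if e = x then 1 else 0 := by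
        intro κ
        simp only [cF, Finset.sum_ite_eq, mem_cycleFinset, mul_ite, mul_one, mul_zero]
        rw [← Finset.sum_filter]
        refine Finset.sum_congr (Finset.ext fun b => ?_) fun _ _ => rfl
        simp [mem_cycleFinset, Equiv.Perm.sameCycle_comm (x := e)]
      have hval : ∀ b : Aω, S (Pi.single ⟨e, he⟩ 1) b =
          (∑ x ∈ cycleFinset σ b.1, if e = x then (1 : ℚ) else 0) -
            ∑ x ∈ cycleFinset τ b.1, if e = x then (1 : ℚ) else 0 := by
        intro b
        rw [hS, Finset.sum_congr rfl fun x _ => hsingle x, Finset.sum_congr rfl fun x _ => hsingle x]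
      rw [Finset.sum_congr rfl fun b _ => congrArg (c b * ·) (hval b),
        hc'sum fun b => (∑ x ∈ cycleFinset σ b, if e = x then (1 : ℚ) else 0) -
          ∑ x ∈ cycleFinset τ b, if e = x then (1 : ℚ) else 0] at this
      simp only [mul_sub, Finset.sum_sub_distrib] at this
      rw [key, key]
      linarith
    · rw [hcF σ hσ e he, hcF τ hτ e he]
  have hconst := hconn (cF σ) (fun a => by simp only [cF, cycleFinset_apply])
    (fun a => by rw [hcFeq]; simp only [cF, cycleFinset_apply])
  refine hc0 (funext fun b => ?_)
  have h1 := hconst b.1 a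
  rw [hcF σ hσ b.1 (b.2.trans_ne hω.ne'), hcF σ hσ a ha.1] at h1
  simpa [c', b.2, ha.2] using h1

end WeightedCycles

section DimerPaths

variable {V A : Type} {D : DimerStruct V A}

lemma isPathFrom_append {u w : V} {l l' : List A} :
    D.IsPathFrom u (l ++ l') w ↔ ∃ v, D.IsPathFrom u l v ∧ D.IsPathFrom v l' w := by
  induction l generalizing u with
  | nil => simp [IsPathFrom]
  | cons a l ih => simp [IsPathFrom, ih, and_assoc]

lemma isPathFrom_orbit (κ : Equiv.Perm A) (hκ : ∀ a, D.src (κ a) = D.tgt a) (a : A) (n : ℕ) :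
    D.IsPathFrom (D.src a) ((List.range n).map fun m => (⇑κ)^[m] a) (D.src ((⇑κ)^[n] a)) := by
  induction n with
  | zero => simp [IsPathFrom]
  | succ n ih =>
    rw [List.range_succ, List.map_append, isPathFrom_append]
    refine ⟨_, ih, rfl, ?_⟩
    rw [Function.iterate_succ_apply', hκ]
    rfl

variable [Finite A]

/-- The face cycle through an arrow is a closed path. -/
lemma isPathFrom_cycle (κ : Equiv.Perm A) (hκ : ∀ a, D.src (κ a) = D.tgt a) (a : A) :
    D.IsPathFrom (D.src a) (a :: (List.range (Function.minimalPeriod (⇑κ) a - 1)).map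
      fun m => (⇑κ)^[m + 1] a) (D.src a) := by
  have := isPathFrom_orbit κ hκ a (Function.minimalPeriod (⇑κ) a)
  rwa [← cons_orbit_eq, Function.iterate_minimalPeriod] at this

lemma isPathFrom_wcyc (a : A) : D.IsPathFrom (D.src a) (D.wcyc a) (D.src a) :=
  isPathFrom_cycle D.nw D.nw_src a

lemma isPathFrom_wpath (a : A) : D.IsPathFrom (D.tgt a) (D.wpath a) (D.src a) :=
  (isPathFrom_cycle D.nw D.nw_src a).2

lemma isPathFrom_bpath (a : A) : D.IsPathFrom (D.tgt a) (D.bpath a) (D.src a) :=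
  (isPathFrom_cycle D.nb D.nb_src a).2

lemma head?_orbit_of_invariant {X : Type*} {f : A → X} {κ : Equiv.Perm A}
    (hf : ∀ a, f (κ a) = f a) {a : A} (ha : κ a ≠ a) (l : List A) :
    ((((List.range (Function.minimalPeriod (⇑κ) a - 1)).map
      fun m => (⇑κ)^[m + 1] a) ++ l).head?.map f) = some (f a) := by
  have h0 := minimalPeriod_perm_pos κ a
  have h1 : Function.minimalPeriod (⇑κ) a ≠ 1 := fun h =>
    ha (Function.minimalPeriod_eq_one_iff_isFixedPt.1 h)
  obtain ⟨k, hk⟩ : ∃ k, Function.minimalPeriod (⇑κ) a - 1 = k + 1 :=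
    ⟨Function.minimalPeriod (⇑κ) a - 2, by omega⟩
  rw [hk, List.range_succ_eq_map]
  simp [hf]

/-- F-term equivalence preserves the value at the first arrow of every function that is
constant on faces. -/
lemma head?_map_eq_of_fTerm (hloop : ∀ a, D.src a ≠ D.tgt a) {X : Type*} {f : A → X}
    (hw : ∀ a, f (D.nw a) = f a) (hb : ∀ a, f (D.nb a) = f a) {x y : V × List A}
    (h : FTerm D x y) : x.2.head?.map f = y.2.head?.map f := by
  induction h with
  | rel u l₁ l₂ a =>
    cases l₁ with
    | nil =>
      have hnw : D.nw a ≠ a := fun h => hloop a (by rw [← D.nw_src, h])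
      have hnb : D.nb a ≠ a := fun h => hloop a (by rw [← D.nb_src, h])
      exact (head?_orbit_of_invariant hw hnw l₂).trans (head?_orbit_of_invariant hb hnb l₂).symm
    | cons b l₁ => rfl
  | refl x => rfl
  | symm _ ih => exact ih.symm
  | trans _ _ ih₁ ih₂ => exact ih₁.trans ih₂

end DimerPaths

section Sections

variable {V A : Type} {D : DimerStruct V A} {n d : ℕ} {T : ToricData n d} {C : Collection T V}
  {φ : A ≃ C.Arrow}

lemma labSum_append (l l' : List A) : labSum φ (l ++ l') = labSum φ l + labSum φ l' := by
  ext ρ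
  simp [labSum]

lemma labSum_cons (a : A) (l : List A) : labSum φ (a :: l) = (φ a).lab + labSum φ l := by
  ext ρ
  simp [labSum]

lemma eq_of_isSection_zero {i j : V} (h : C.IsSection i j 0) : j = i := by
  refine C.distinct j i ?_
  have : toInt (0 : Fin d → ℕ) - (C.D j - C.D i) = -(C.D j - C.D i) := by
    ext ρ
    simp [toInt]
  rw [Collection.IsSection, this] at h
  exact neg_mem_iff.1 h

/-- Every torus-invariant section is realised by a path of the quiver of sections. -/
lemma exists_path_of_isSection (hφ : ∀ a : A, (φ a).src = D.src a ∧ (φ a).tgt = D.tgt a)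
    (u : Fin d → ℕ) (i j : V) (hu : C.IsSection i j u) :
    ∃ l, D.IsPathFrom i l j ∧ labSum φ l = u := by
  induction hN : ∑ ρ, u ρ using Nat.strong_induction_on generalizing u i j with
  | _ N ih =>
  by_cases hu0 : u = 0
  · subst hu0
    exact ⟨[], (eq_of_isSection_zero hu).symm, by ext ρ; simp [labSum]⟩
  by_cases hirr : C.IsIrreducible i j u
  · obtain ⟨a, ha⟩ := φ.surjective ⟨i, j, u, hirr, fun h => hu0 h.2⟩
    refine ⟨[a], ⟨?_, ?_⟩, ?_⟩
    · rw [← (hφ a).1, ha]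
    · change D.tgt a = j
      rw [← (hφ a).2, ha]
    · ext ρ
      simp [labSum, ha]
  · simp only [Collection.IsIrreducible, hu, true_and] at hirr
    push Not at hirr
    obtain ⟨k, u₁, u₂, rfl, h₂, h₁, hne₂, hne₁⟩ := hirr
    have hu₂ : u₂ ≠ 0 := fun h => hne₂ (eq_of_isSection_zero (h ▸ h₂)) h
    have hu₁ : u₁ ≠ 0 := fun h => hne₁ (eq_of_isSection_zero (h ▸ h₁)).symm h
    have hpos : ∀ v : Fin d → ℕ, v ≠ 0 → 0 < ∑ ρ, v ρ := fun v hv =>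
      Nat.pos_of_ne_zero fun h => hv (funext fun ρ => by simpa using (Finset.sum_eq_zero_iff.1 h) ρ)
    have hp₁ := hpos u₁ hu₁
    have hp₂ := hpos u₂ hu₂
    have hsum : ∑ ρ, (u₁ + u₂) ρ = ∑ ρ, u₁ ρ + ∑ ρ, u₂ ρ := by
      simp [Finset.sum_add_distrib]
    obtain ⟨l₂, hl₂, rfl⟩ := ih _ (by omega) u₂ i k h₂ rfl
    obtain ⟨l₁, hl₁, rfl⟩ := ih _ (by omega) u₁ k j h₁ rfl
    exact ⟨l₂ ++ l₁, isPathFrom_append.2 ⟨k, hl₂, hl₁⟩, by rw [labSum_append, add_comm]⟩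

/-- The character `m ∈ M` with `div(a) = ι(m) + D_{h(a)} - D_{t(a)}` attached to an arrow. -/
noncomputable def arrowChar (φ : A ≃ C.Arrow) (a : A) : Fin n → ℤ := (φ a).irred.1.choose

lemma iota_arrowChar (hφ : ∀ a : A, (φ a).src = D.src a ∧ (φ a).tgt = D.tgt a) (a : A) :
    T.iota (arrowChar φ a) = toInt (φ a).lab - (C.D (D.tgt a) - C.D (D.src a)) := by
  rw [← (hφ a).1, ← (hφ a).2]
  exact (φ a).irred.1.choose_spec

lemma iota_injective (T : ToricData n d) : Function.Injective T.iota := by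
  rw [injective_iff_map_eq_zero]
  exact fun u hu => T.full_dim u fun ρ => congrFun hu ρ

lemma iota_sum_arrowChar (hφ : ∀ a : A, (φ a).src = D.src a ∧ (φ a).tgt = D.tgt a)
    {i j : V} {l : List A} (h : D.IsPathFrom i l j) :
    T.iota (l.map (arrowChar φ)).sum = toInt (labSum φ l) - (C.D j - C.D i) := by
  induction l generalizing i with
  | nil =>
    obtain rfl : i = j := h
    ext ρ
    simp [toInt, labSum]
  | cons a l ih =>
    obtain ⟨rfl, h⟩ := h
    rw [List.map_cons, List.sum_cons, map_add, ih h, iota_arrowChar hφ, labSum_cons]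
    ext ρ
    simp only [toInt, Pi.add_apply, Pi.sub_apply, Nat.cast_add]
    ring

/-- Given a ray `ρ` and a character `w` vanishing on `ρ` and positive on the other rays, a
divisor of class `D_j - D_i` effective along `ρ` becomes a path after adding a multiple of `w`. -/
lemma exists_path_of_ray (hφ : ∀ a : A, (φ a).src = D.src a ∧ (φ a).tgt = D.tgt a)
    {ρ : Fin d} {w : Fin n → ℤ} (hwρ : T.iota w ρ = 0) (hw : ∀ ρ', ρ' ≠ ρ → 0 < T.iota w ρ')
    (i j : V) (m : Fin n → ℤ) (hm : 0 ≤ T.iota m ρ + (C.D j ρ - C.D i ρ)) :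
    ∃ (N : ℕ) (l : List A), D.IsPathFrom i l j ∧ (l.map (arrowChar φ)).sum = m + N • w ∧
      (labSum φ l ρ : ℤ) = T.iota m ρ + (C.D j ρ - C.D i ρ) := by
  let e : Fin d → ℤ := fun ρ' => T.iota m ρ' + (C.D j ρ' - C.D i ρ')
  let N : ℕ := ∑ ρ', (e ρ').natAbs
  have heff : ∀ ρ', 0 ≤ e ρ' + N * T.iota w ρ' := by
    intro ρ'
    by_cases h : ρ' = ρ
    · subst h
      simpa [hwρ] using hm
    · have h1 : ((e ρ').natAbs : ℤ) ≤ N := by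
        exact_mod_cast Finset.single_le_sum (f := fun ρ' => (e ρ').natAbs)
          (fun _ _ => Nat.zero_le _) (Finset.mem_univ ρ')
      have h2 := hw ρ' h
      have h3 : (N : ℤ) ≤ N * T.iota w ρ' := le_mul_of_one_le_right (by positivity) (by omega)
      omega
  let u : Fin d → ℕ := fun ρ' => (e ρ' + N * T.iota w ρ').toNat
  have hu : ∀ ρ', (u ρ' : ℤ) = e ρ' + N * T.iota w ρ' := fun ρ' => Int.toNat_of_nonneg (heff ρ')
  have hiota : T.iota (m + N • w) = toInt u - (C.D j - C.D i) := by
    ext ρ'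
    rw [map_add, map_nsmul, Pi.add_apply, Pi.smul_apply, nsmul_eq_mul]
    simp only [toInt, Pi.sub_apply, hu, e]
    ring
  obtain ⟨l, hl, hlu⟩ := exists_path_of_isSection hφ u i j ⟨m + N • w, hiota⟩
  refine ⟨N, l, hl, iota_injective T ?_, ?_⟩
  · rw [iota_sum_arrowChar hφ hl, hlu, hiota]
  · rw [hlu, hu, hwρ, mul_zero, add_zero]

lemma exists_sum_mul_eq_gcd {ι : Type*} (s : Finset ι) (v : ι → ℤ) :
    ∃ z : ι → ℤ, ∑ i ∈ s, z i * v i = (s.gcd (fun i => (v i).natAbs) : ℕ) := by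
  classical
  induction s using Finset.induction_on with
  | empty => exact ⟨0, by simp⟩
  | insert a s ha ih =>
    obtain ⟨z, hz⟩ := ih
    set g := s.gcd fun i => (v i).natAbs
    refine ⟨fun i => if i = a then Int.gcdA (v a) g else Int.gcdB (v a) g * z i, ?_⟩
    have hs : ∑ i ∈ s, (if i = a then Int.gcdA (v a) g else Int.gcdB (v a) g * z i) * v i =
        Int.gcdB (v a) g * g := by
      rw [← hz, Finset.mul_sum]
      refine Finset.sum_congr rfl fun i hi => ?_
      rw [if_neg (by rintro rfl; exact ha hi), mul_assoc]
    rw [Finset.sum_insert ha, hs]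
    beta_reduce
    rw [if_pos rfl, Finset.gcd_insert]
    have := Int.gcd_eq_gcd_ab (v a) g
    rw [mul_comm _ (v a), mul_comm _ (g : ℤ), ← this]
    simp [Int.gcd, g, gcd_eq_nat_gcd]

lemma exists_iota_eq_one (T : ToricData n d) (ρ : Fin d) : ∃ z, T.iota z ρ = 1 := by
  obtain ⟨z, hz⟩ := exists_sum_mul_eq_gcd Finset.univ (T.v ρ)
  exact ⟨z, by rw [T.primitive ρ] at hz; exact_mod_cast hz⟩

/-- The cochain on arrows attached to a function on vertices and a one-parameter subgroup. -/
noncomputable def cochain (D : DimerStruct V A) (φ : A ≃ C.Arrow) :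
    ((V → ℚ) × (Fin n → ℚ)) →ₗ[ℚ] A → ℚ where
  toFun x a := x.1 (D.tgt a) - x.1 (D.src a) + ∑ i, x.2 i * arrowChar φ a i
  map_add' x y := by
    ext a
    simp only [Prod.fst_add, Prod.snd_add, Pi.add_apply, add_mul, Finset.sum_add_distrib]
    ring
  map_smul' r x := by
    ext a
    simp only [Prod.smul_fst, Prod.smul_snd, Pi.smul_apply, smul_eq_mul, RingHom.id_apply, mul_assoc,
      ← Finset.mul_sum]
    ring

lemma cochain_apply (x : (V → ℚ) × (Fin n → ℚ)) (a : A) :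
    cochain D φ x a = x.1 (D.tgt a) - x.1 (D.src a) + ∑ i, x.2 i * arrowChar φ a i := rfl

lemma sum_cochain_path (x : (V → ℚ) × (Fin n → ℚ)) {i j : V} {l : List A}
    (h : D.IsPathFrom i l j) :
    (l.map (cochain D φ x)).sum =
      x.1 j - x.1 i + ∑ k, x.2 k * ((l.map (arrowChar φ)).sum k : ℤ) := by
  induction l generalizing i with
  | nil =>
    obtain rfl : i = j := h
    simp
  | cons a l ih =>
    obtain ⟨rfl, h⟩ := h
    rw [List.map_cons, List.sum_cons, ih h, cochain_apply, List.map_cons, List.sum_cons]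
    simp only [Pi.add_apply, Int.cast_add, mul_add, Finset.sum_add_distrib]
    ring

/-- A cochain vanishing on the arrows whose label avoids `ρ` is determined by its value at one
vertex and its pairing with one character. -/
lemma eq_zero_of_cochain_eq_zero
    (hφ : ∀ a : A, (φ a).src = D.src a ∧ (φ a).tgt = D.tgt a) {ρ : Fin d}
    {z : Fin n → ℤ} (hz : T.iota z ρ = 1) (i₀ : V) {x : (V → ℚ) × (Fin n → ℚ)}
    (hx : ∀ a, (φ a).lab ρ = 0 → cochain D φ x a = 0) (hxi : x.1 i₀ = 0)
    (hxz : ∑ k, x.2 k * (z k : ℚ) = 0) : x = 0 := by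
  obtain ⟨w, hwρ, hw⟩ := T.extremal_rays ρ
  let pair : (Fin n → ℤ) →+ ℚ :=
    { toFun := fun m => ∑ k, x.2 k * (m k : ℚ)
      map_zero' := by simp
      map_add' := fun m m' => by simp [mul_add, Finset.sum_add_distrib] }
  have hpath : ∀ (i j : V) (m : Fin n → ℤ), T.iota m ρ + (C.D j ρ - C.D i ρ) = 0 →
      ∃ N : ℕ, x.1 j - x.1 i + (pair m + N * pair w) = 0 := by
    intro i j m hm
    obtain ⟨N, l, hl, hchar, hlab⟩ := exists_path_of_ray hφ (w := w) hwρ hw i j m hm.ge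
    refine ⟨N, ?_⟩
    have hlab0 : ∀ a ∈ l, (φ a).lab ρ = 0 := by
      have : (l.map fun a => (φ a).lab ρ).sum = 0 := by exact_mod_cast hlab.trans hm
      exact fun a ha => (List.sum_eq_zero_iff.1 this) _ (List.mem_map_of_mem ha)
    have hsum : (l.map (cochain D φ x)).sum = 0 :=
      List.sum_eq_zero fun y hy => by
        obtain ⟨a, ha, rfl⟩ := List.mem_map.1 hy
        exact hx a (hlab0 a ha)
    rw [sum_cochain_path x hl, hchar] at hsum
    have : pair (m + N • w) = pair m + N * pair w := by
      rw [map_add, map_nsmul, nsmul_eq_mul]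
    rw [← this]
    exact hsum
  have hpw : pair w = 0 := by
    obtain ⟨N, hN⟩ := hpath i₀ i₀ w (by rw [sub_self, add_zero]; exact hwρ)
    have hN' : (1 + (N : ℚ)) * pair w = 0 := by linarith
    exact (mul_eq_zero.1 hN').resolve_left (by positivity)
  have hpair : ∀ m, pair m = 0 := by
    intro m
    obtain ⟨N, hN⟩ := hpath i₀ i₀ (m - T.iota m ρ • z) (by
      rw [map_sub, map_zsmul]
      simp [hz])
    have hpz : pair z = 0 := hxz
    rw [map_sub, map_zsmul, hpz, hpw] at hN
    simpa using hN
  refine Prod.ext (funext fun j => ?_) (funext fun k => ?_)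
  · obtain ⟨N, hN⟩ := hpath i₀ j (-(C.D j ρ - C.D i₀ ρ) • z) (by
      rw [map_zsmul]
      simp [hz])
    rw [hpair, hpair, hxi] at hN
    simpa using hN
  · have := hpair (Pi.single k 1)
    simpa [pair, Pi.single_apply] using this

end Sections

section Labels

variable {V A : Type} [Fintype A] {D : DimerStruct V A} {n d : ℕ} {T : ToricData n d}
  {C : Collection T V} {φ : A ≃ C.Arrow}

/-- Functions constant on faces are constant. -/
lemma const_of_face_invariant (hloop : ∀ a, D.src a ≠ D.tgt a)
    (hφ : ∀ a : A, (φ a).src = D.src a ∧ (φ a).tgt = D.tgt a)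
    (hiso : ∀ (u w : V) (l l' : List A), D.IsPathFrom u l w → D.IsPathFrom u l' w →
      (labSum φ l = labSum φ l' ↔ FTerm D (u, l) (u, l')))
    (ρ : Fin d) {X : Type*} (f : A → X)
    (hw : ∀ a, f (D.nw a) = f a) (hb : ∀ a, f (D.nb a) = f a) (a b : A) : f a = f b := by
  have hvert : ∀ a b, D.src a = D.src b → f a = f b := by
    intro a b hab
    have ha := isPathFrom_wcyc (D := D) a
    have hb' := isPathFrom_wcyc (D := D) b
    rw [← hab] at hb'
    have := head?_map_eq_of_fTerm hloop hw hb ((hiso _ _ _ _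
      (isPathFrom_append.2 ⟨_, ha, hb'⟩) (isPathFrom_append.2 ⟨_, hb', ha⟩)).1
        (by rw [labSum_append, labSum_append, add_comm]))
    simpa [wcyc] using this
  have hpath : ∀ (l : List A) (a b : A), D.IsPathFrom (D.src a) l (D.src b) → f a = f b := by
    intro l
    induction l with
    | nil => exact fun a b h => hvert a b h
    | cons c l ih =>
      rintro a b ⟨hca, h⟩
      rw [← D.nw_src] at h
      rw [hvert a c hca.symm, ← hw c]
      exact ih _ _ h
  obtain ⟨w, hwρ, hw'⟩ := T.extremal_rays ρ
  obtain ⟨z, hz⟩ := exists_iota_eq_one T ρ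
  obtain ⟨-, l, hl, -⟩ := exists_path_of_ray hφ (w := w) hwρ hw' (D.src a) (D.src b)
    (-(C.D (D.src b) ρ - C.D (D.src a) ρ) • z) (by rw [map_zsmul]; simp [hz])
  exact hpath l a b hl

variable [DecidableEq A]

/-- All faces have the same labelling divisor. -/
lemma exists_face_label (hloop : ∀ a, D.src a ≠ D.tgt a)
    (hφ : ∀ a : A, (φ a).src = D.src a ∧ (φ a).tgt = D.tgt a)
    (hiso : ∀ (u w : V) (l l' : List A), D.IsPathFrom u l w → D.IsPathFrom u l' w →
      (labSum φ l = labSum φ l' ↔ FTerm D (u, l) (u, l')))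
    (ρ : Fin d) (a₀ : A) :
    ∃ Ω : Fin d → ℕ, (∀ a, ∑ b ∈ cycleFinset D.nw a, (φ b).lab = Ω) ∧
      ∀ a, ∑ b ∈ cycleFinset D.nb a, (φ b).lab = Ω := by
  have hlist : ∀ l : List A, labSum φ l = (l.map fun b => (φ b).lab).sum := by
    intro l
    induction l with
    | nil => ext; simp [labSum]
    | cons a l ih => rw [labSum_cons, ih, List.map_cons, List.sum_cons]
  have hwb : ∀ a, ∑ b ∈ cycleFinset D.nw a, (φ b).lab = ∑ b ∈ cycleFinset D.nb a, (φ b).lab := by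
    intro a
    rw [← sum_orbit_eq, ← sum_orbit_eq, ← hlist, ← hlist, labSum_cons, labSum_cons]
    congr 1
    refine (hiso _ _ _ _ (isPathFrom_wpath a) (isPathFrom_bpath a)).2 ?_
    simpa using FTerm.rel (D := D) (D.tgt a) [] [] a
  have hconst := const_of_face_invariant hloop hφ hiso ρ
    (fun a => ∑ b ∈ cycleFinset D.nw a, (φ b).lab) (fun a => by simp only [cycleFinset_apply])
    (fun a => by simp only [hwb, cycleFinset_apply])
  exact ⟨_, fun a => hconst a a₀, fun a => (hwb a).symm.trans (hconst a a₀)⟩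

lemma iota_sum_arrowChar_face (hφ : ∀ a : A, (φ a).src = D.src a ∧ (φ a).tgt = D.tgt a)
    (κ : Equiv.Perm A) (hκ : ∀ a, D.src (κ a) = D.tgt a) (a : A) :
    T.iota (∑ b ∈ cycleFinset κ a, arrowChar φ b) =
      toInt (∑ b ∈ cycleFinset κ a, (φ b).lab) := by
  have h := iota_sum_arrowChar hφ (isPathFrom_cycle κ hκ a)
  rw [sum_orbit_eq, sub_self, sub_zero] at h
  rw [h]
  congr 1
  ext ρ
  rw [labSum, sum_orbit_eq, Finset.sum_apply]

lemma sum_cochain_face (κ : Equiv.Perm A) (hκ : ∀ a, D.src (κ a) = D.tgt a)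
    (x : (V → ℚ) × (Fin n → ℚ)) (a : A) :
    ∑ b ∈ cycleFinset κ a, cochain D φ x b =
      ∑ i, x.2 i * ((∑ b ∈ cycleFinset κ a, arrowChar φ b) i : ℤ) := by
  simp only [cochain_apply, Finset.sum_add_distrib, Finset.sum_sub_distrib, ← hκ]
  rw [sum_cycleFinset_comp κ a fun b => x.1 (D.src b), sub_self, zero_add, Finset.sum_comm]
  simp [Finset.mul_sum]

end Labels

/-- Lemma 5.4: for any algebraically consistent dimer model `Γ` with
quiver `Q` — so that `Q` is the quiver of sections of a collection `𝓔` of rank one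
reflexive modules on the three-dimensional Gorenstein affine toric variety
`X = Spec Z(A_Γ)`, with `A_Γ ≅ A_𝓔` — and for any arrow `a ∈ Q₁`, the labelling
monomial `x^{div a}` divides `Π_{ρ ∈ σ(1)} x_ρ`; equivalently
`⟨Π_ρ, π(χ_a)⟩ = div(a)_ρ ∈ {0,1}` for every extremal perfect matching `Π_ρ`. -/
theorem dimer_arrow_label_squarefree
    {V A : Type} [Fintype V] [Fintype A] [DecidableEq V] [DecidableEq A]
    (D : DimerStruct V A) (htor : D.IsTorusDimer) (hcon : D.AlgConsistent)
    {d : ℕ} (T : ToricData 3 d) (hGor : T.Gorenstein)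
    (C : Collection T V)
    (φ : A ≃ C.Arrow)
    (hφ : ∀ a : A, (φ a).src = D.src a ∧ (φ a).tgt = D.tgt a)
    (hiso : ∀ (u w : V) (l l' : List A), D.IsPathFrom u l w → D.IsPathFrom u l' w →
      (labSum φ l = labSum φ l' ↔ FTerm D (u, l) (u, l'))) :
    ∀ (a : A) (ρ : Fin d), (φ a).lab ρ = 0 ∨ (φ a).lab ρ = 1 := by
  classical
  intro a ρ
  obtain ⟨heuler, -, hloop, -, -⟩ := htor
  obtain ⟨Ω, hΩw, hΩb⟩ := exists_face_label hloop hφ hiso ρ a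
  obtain ⟨z, hz⟩ := exists_iota_eq_one T ρ
  obtain ⟨w, hwρ, hw⟩ := T.extremal_rays ρ
  have hσ : ∀ a, ∑ e ∈ cycleFinset D.nw a, (φ e).lab ρ = Ω ρ := fun a => by
    rw [← hΩw a, Finset.sum_apply]
  have hτ : ∀ a, ∑ e ∈ cycleFinset D.nb a, (φ e).lab ρ = Ω ρ := fun a => by
    rw [← hΩb a, Finset.sum_apply]
  obtain ⟨-, l, -, -, hl⟩ := exists_path_of_ray hφ (w := w) hwρ hw (D.src a) (D.src a) z
    (by simp [hz])
  have hl1 : (l.map fun a => (φ a).lab ρ).sum = 1 := by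
    rw [hz, sub_self, add_zero] at hl
    exact_mod_cast hl
  have hω : 0 < Ω ρ := by
    by_contra h0
    have hzero : (l.map fun a => (φ a).lab ρ).sum = 0 := List.sum_eq_zero fun y hy => by
      obtain ⟨b, -, rfl⟩ := List.mem_map.1 hy
      have := Finset.single_le_sum (f := fun e => (φ e).lab ρ) (fun _ _ => Nat.zero_le _)
        (self_mem_cycleFinset D.nw b)
      rw [hσ b] at this
      omega
    omega
  let g : ((V → ℚ) × (Fin 3 → ℚ)) →ₗ[ℚ] ℚ × ℚ :=
    (LinearMap.proj (D.src a) ∘ₗ LinearMap.fst ℚ (V → ℚ) (Fin 3 → ℚ)).prod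
      (Fintype.linearCombination ℚ (fun k => (z k : ℚ)) ∘ₗ LinearMap.snd ℚ (V → ℚ) (Fin 3 → ℚ))
  have hval : ∀ b, (φ b).lab ρ = 0 ∨ (φ b).lab ρ = Ω ρ := by
    refine weight_eq_zero_or_eq_total hω hσ hτ heuler
      (fun f => const_of_face_invariant hloop hφ hiso ρ f) (by simp) (cochain D φ) ?_ g ?_
    · intro x b
      have hchar : ∑ e ∈ cycleFinset D.nw b, arrowChar φ e =
          ∑ e ∈ cycleFinset D.nb b, arrowChar φ e := by
        apply iota_injective T
        rw [iota_sum_arrowChar_face hφ D.nw D.nw_src, iota_sum_arrowChar_face hφ D.nb D.nb_src,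
          hΩw, hΩb]
      rw [sum_cochain_face D.nw D.nw_src, sum_cochain_face D.nb D.nb_src, hchar]
    · intro x hx hgx
      obtain ⟨h1, h2⟩ := Prod.mk.inj hgx
      exact eq_zero_of_cochain_eq_zero hφ hz (D.src a) hx h1 h2
  have hdvd : Ω ρ ∣ (l.map fun a => (φ a).lab ρ).sum := List.dvd_sum fun y hy => by
    obtain ⟨b, -, rfl⟩ := List.mem_map.1 hy
    rcases hval b with h | h <;> simp [h]
  rw [hl1, Nat.dvd_one] at hdvd
  rw [← hdvd]
  exact hval a
end
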